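/- Suppose d < δ, and let F = B(n+1; d_1,…,d_n,d) be the set of standard monomials of (I,g) in K[x_1,…,x_n,z], with F_k the monomials of degree k in F. Then: F_0 = {1}; F_i = B_i ∪ z·F_{i−1} for 1 ≤ i ≤ d−1; F_d = (B_d ∖ {the largest monomial of B_d}) ∪ z·F_{d−1}; there exist subsets S_i ⊆ {1,…,a_{d+i}} with |S_i| = a_i such that F_{d+i} = B_{d+i}^{{1,…,a_{d+i}} ∖ S_i} ∪ z·F_{d+i−1} for 1 ≤ i ≤ i*−1 if δ−d is even (respectively for 1 ≤ i ≤ i* if δ−d is odd); and F_k = z^{2(k−d−i*)+1}·F_{2(d+i*)−1−k} for d+i* ≤ k ≤ δ+d−1 if δ−d is even (respectively F_k = z^{2(k−d−i*)}·F_{2(d+i*)−k} for d+i*+1 ≤ k ≤ δ+d−1 if δ−d is odd). -/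

import Mathlib

open MvPolynomial

/-- The total degree of an exponent vector. -/
def expDeg {n : ℕ} (μ : Fin n →₀ ℕ) : ℕ := μ.sum fun _ e => e

/-- Strict degree reverse lexicographic order on exponent vectors, for variables
`x_1 > ⋯ > x_n` (indexed by `Fin n` in this order). -/
def DrlLT {n : ℕ} (a b : Fin n →₀ ℕ) : Prop :=
  expDeg a < expDeg b ∨
    (expDeg a = expDeg b ∧ ∃ i : Fin n, b i < a i ∧ ∀ j : Fin n, i < j → a j = b j)

/-- `μ` is the leading (degrevlex-largest) exponent of `p`. -/
def IsLeadExp {n : ℕ} {K : Type*} [CommSemiring K] (p : MvPolynomial (Fin n) K)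
    (μ : Fin n →₀ ℕ) : Prop :=
  μ ∈ p.support ∧ ∀ ν ∈ p.support, ν ≠ μ → DrlLT ν μ

/-- The initial ideal of `I` with respect to the degree reverse lexicographic order. -/
noncomputable def initialIdeal {n : ℕ} {K : Type*} [CommRing K]
    (I : Ideal (MvPolynomial (Fin n) K)) : Ideal (MvPolynomial (Fin n) K) :=
  Ideal.span { m | ∃ p ∈ I, p ≠ 0 ∧ ∃ μ, IsLeadExp p μ ∧ m = monomial μ (1 : K) }

/-- The standard monomials of degree `i` of `I` : exponents of the monomials of degree `i`
not lying in the initial ideal of `I`. -/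
def stdMon {n : ℕ} {K : Type*} [CommRing K] (I : Ideal (MvPolynomial (Fin n) K)) (i : ℕ) :
    Set (Fin n →₀ ℕ) :=
  { μ | expDeg μ = i ∧ monomial μ (1 : K) ∉ initialIdeal I }

/-- `μ` is a minimal monomial generator of the monomial ideal `M`. -/
def IsMinGen {n : ℕ} {K : Type*} [CommRing K] (M : Ideal (MvPolynomial (Fin n) K))
    (μ : Fin n →₀ ℕ) : Prop :=
  monomial μ (1 : K) ∈ M ∧ ∀ ν : Fin n →₀ ℕ, ν ≤ μ → ν ≠ μ → monomial ν (1 : K) ∉ M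

/-- `μ` satisfies property `P` with respect to the monomial ideal `M`: if `m` is the largest
index of a variable dividing `x^μ`, then every monomial of the same degree in the variables of
index `< m` also lies in `M`. -/
def SatisfiesP {n : ℕ} {K : Type*} [CommRing K] (M : Ideal (MvPolynomial (Fin n) K))
    (μ : Fin n →₀ ℕ) : Prop :=
  ∀ m : Fin n, μ m ≠ 0 → (∀ j : Fin n, m < j → μ j = 0) →
    ∀ ν : Fin n →₀ ℕ, expDeg ν = expDeg μ → (∀ j : Fin n, m ≤ j → ν j = 0) →
      monomial ν (1 : K) ∈ M

/-- Conjecture E (Pardue) holds for the ideal `I`: every minimal generator of the initial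
ideal of `I` satisfies property `P`. -/
def ConjE {n : ℕ} {K : Type*} [CommRing K] (I : Ideal (MvPolynomial (Fin n) K)) : Prop :=
  ∀ μ, IsMinGen (initialIdeal I) μ → SatisfiesP (initialIdeal I) μ

/-- `f` is a generic sequence of forms of degrees `d i` over the base field `F`: each `f i` is
homogeneous of degree `d i` and the family of all coefficients (at all monomials of degree
`d i`) is algebraically independent over `F`. -/
def IsGenericSeq (F : Type*) {K : Type*} [CommRing F] [CommRing K] [Algebra F K]
    {n r : ℕ} (d : Fin r → ℕ) (f : Fin r → MvPolynomial (Fin n) K) : Prop :=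
  (∀ i, (f i).IsHomogeneous (d i)) ∧
    AlgebraicIndependent F
      (fun p : Σ i : Fin r, { μ : Fin n →₀ ℕ // expDeg μ = d i } => (f p.1).coeff p.2.1)

/-- The projection `K[x_1,…,x_n,z] → K[x_1,…,x_n]` sending `z` (the last variable) to `0` and
fixing the other variables. -/
noncomputable def projMap (K : Type*) [CommRing K] (n : ℕ) :
    MvPolynomial (Fin (n + 1)) K →ₐ[K] MvPolynomial (Fin n) K :=
  aeval (fun i => Fin.lastCases 0 (fun j => X j) i)

/-- Embedding of exponent vectors of `K[x_1,…,x_n]` into those of `K[x_1,…,x_n,z]`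
(`z`-exponent `0`). -/
noncomputable def embExp {n : ℕ} (μ : Fin n →₀ ℕ) : Fin (n + 1) →₀ ℕ :=
  Finsupp.embDomain ⟨Fin.castSucc, Fin.castSucc_injective n⟩ μ

/-- Multiplication by `z^c` on exponent vectors in `K[x_1,…,x_n,z]`. -/
noncomputable def zShift {n : ℕ} (c : ℕ) (μ : Fin (n + 1) →₀ ℕ) : Fin (n + 1) →₀ ℕ :=
  μ + Finsupp.single (Fin.last n) c

/-- `f` (homogeneous of degree `e`) is semi-regular on `R/I`: in each degree `t`, the
multiplication map `(R/I)_t → (R/I)_{t+e}` is injective or surjective. -/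
def SemiRegularOn {vars K : Type*} [CommRing K] (I : Ideal (MvPolynomial vars K))
    (f : MvPolynomial vars K) (e : ℕ) : Prop :=
  ∀ t : ℕ,
    (∀ p ∈ homogeneousSubmodule vars K t, f * p ∈ I → p ∈ I) ∨
    (∀ q ∈ homogeneousSubmodule vars K (t + e),
      ∃ p ∈ homogeneousSubmodule vars K t, q - f * p ∈ I)

/-- The degree-`t` graded piece of `R/I`, as a `K`-submodule of the quotient. -/
noncomputable def quotDegPart {vars K : Type*} [CommRing K] (I : Ideal (MvPolynomial vars K))
    (t : ℕ) : Submodule K (MvPolynomial vars K ⧸ I) :=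
  (homogeneousSubmodule vars K t).map (Ideal.Quotient.mkₐ K I).toLinearMap

/-- If a specialization of a family of vectors over a field spans, then so does every
specialization at which a certain minor does not vanish. -/
theorem exists_minor_of_span_eq_top {κ β S L₀ : Type*} [Finite β] [CommRing S] [Field L₀]
    (v : κ → β → S) (ev₀ : S →+* L₀)
    (h : Submodule.span L₀ (Set.range fun k b => ev₀ (v k b)) = ⊤) :
    ∃ G : S, ev₀ G ≠ 0 ∧ ∀ {L : Type*} [Field L] (ev : S →+* L), ev G ≠ 0 →
      Submodule.span L (Set.range fun k b => ev (v k b)) = ⊤ := by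
  classical
  have := Fintype.ofFinite β
  obtain ⟨κ', a, -, hspan, hli⟩ := exists_linearIndependent' L₀ (fun k b => ev₀ (v k b))
  have hb : ⊤ ≤ Submodule.span L₀ (Set.range ((fun k b => ev₀ (v k b)) ∘ a)) := by
    rw [hspan, h]
  let e : β ≃ κ' := (Pi.basisFun L₀ β).indexEquiv (Module.Basis.mk hli hb)
  let N : Matrix β β S := Matrix.of fun b => v (a (e b))
  refine ⟨N.det, ?_, ?_⟩
  · have h1 : LinearIndependent L₀ (ev₀.mapMatrix N).row := hli.comp e e.injective
    rw [Matrix.linearIndependent_rows_iff_isUnit, Matrix.isUnit_iff_isUnit_det,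
      ← RingHom.map_det] at h1
    exact h1.ne_zero
  · intro L _ ev hG
    rw [RingHom.map_det] at hG
    have h1 : LinearIndependent L (ev.mapMatrix N).row := by
      rw [Matrix.linearIndependent_rows_iff_isUnit, Matrix.isUnit_iff_isUnit_det]
      exact hG.isUnit
    have h2 := h1.span_eq_top_of_card_eq_finrank' (by simp)
    rw [eq_top_iff, ← h2]
    refine Submodule.span_mono ?_
    rintro _ ⟨b, rfl⟩
    exact ⟨a (e b), rfl⟩

/-- The ideal `I` contains every form of degree `t`. -/
def ContainsForms {σ K : Type*} [CommSemiring K] (I : Ideal (MvPolynomial σ K)) (t : ℕ) : Prop :=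
  ∀ h : MvPolynomial σ K, h.IsHomogeneous t → h ∈ I

theorem mem_ideal_span_iff_mem_span_monomial_mul {σ ι K : Type*} [CommRing K]
    (φ : ι → MvPolynomial σ K) (h : MvPolynomial σ K) :
    h ∈ Ideal.span (Set.range φ) ↔
      h ∈ Submodule.span K (Set.range fun p : ι × (σ →₀ ℕ) => monomial p.2 (1 : K) * φ p.1) := by
  constructor
  · intro hh
    refine Submodule.span_induction ?_ (zero_mem _) (fun _ _ _ _ => add_mem) ?_ hh
    · rintro _ ⟨i, rfl⟩
      exact Submodule.subset_span ⟨(i, 0), by simp⟩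
    · intro a x _ hx
      rw [smul_eq_mul]
      induction a using MvPolynomial.induction_on' with
      | add p q hp hq => rw [add_mul]; exact add_mem hp hq
      | monomial u c =>
        refine Submodule.span_induction ?_ ?_ ?_ ?_ hx
        · rintro _ ⟨⟨i, w⟩, rfl⟩
          have : monomial u c * (monomial w (1 : K) * φ i)
              = c • (monomial (u + w) (1 : K) * φ i) := by
            rw [← mul_assoc, monomial_mul, mul_one, ← smul_mul_assoc, smul_monomial]
            simp
          rw [this]
          exact Submodule.smul_mem _ _ (Submodule.subset_span ⟨(i, u + w), rfl⟩)
        · simp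
        · intro x y _ _ hx hy
          rw [mul_add]; exact add_mem hx hy
        · intro r x _ hx
          rw [mul_smul_comm]; exact Submodule.smul_mem _ _ hx
  · intro hh
    refine Submodule.span_induction (p := fun x _ => x ∈ Ideal.span (Set.range φ))
      ?_ (zero_mem _) (fun _ _ _ _ => add_mem) ?_ hh
    · rintro _ ⟨⟨i, w⟩, rfl⟩
      exact Ideal.mul_mem_left _ _ (Ideal.subset_span ⟨i, rfl⟩)
    · intro r x _ hx
      rw [smul_eq_C_mul]; exact Ideal.mul_mem_left _ _ hx

theorem homogeneousComponent_mem_span_monomial_mul {σ ι K : Type*} [CommRing K]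
    (φ : ι → MvPolynomial σ K) (e : ι → ℕ) (hφ : ∀ i, (φ i).IsHomogeneous (e i)) (t : ℕ)
    {h : MvPolynomial σ K} (hh : h ∈ Ideal.span (Set.range φ)) :
    homogeneousComponent t h ∈ Submodule.span K
      (Set.range fun p : {p : ι × (σ →₀ ℕ) // p.2.degree + e p.1 = t} =>
        monomial p.1.2 (1 : K) * φ p.1.1) := by
  rw [mem_ideal_span_iff_mem_span_monomial_mul] at hh
  refine Submodule.span_induction ?_ (by simp) ?_ ?_ hh
  · rintro _ ⟨⟨i, w⟩, rfl⟩
    have hw : (monomial w (1 : K) * φ i).IsHomogeneous (w.degree + e i) :=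
      (isHomogeneous_monomial _ rfl).mul (hφ i)
    dsimp only
    rw [homogeneousComponent_of_mem hw]
    split_ifs with h1
    · exact Submodule.subset_span ⟨⟨(i, w), h1.symm⟩, rfl⟩
    · exact zero_mem _
  · intro x y _ _ hx hy
    rw [map_add]; exact add_mem hx hy
  · intro r x _ hx
    rw [map_smul]; exact Submodule.smul_mem _ _ hx

instance finite_degree_eq {σ : Type*} [Finite σ] (t : ℕ) :
    Finite {μ : σ →₀ ℕ // μ.degree = t} :=
  ((Finsupp.finite_of_degree_le (σ := σ) t).subset fun _ h => le_of_eq h).to_subtype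

/-- The coefficients of a polynomial at the monomials of degree `t`. -/
noncomputable def coeffVec {σ K : Type*} [CommRing K] (t : ℕ) :
    MvPolynomial σ K →ₗ[K] ({μ : σ →₀ ℕ // μ.degree = t} → K) :=
  LinearMap.pi fun b => lcoeff K b.1

theorem coeffVec_apply {σ K : Type*} [CommRing K] (t : ℕ) (p : MvPolynomial σ K)
    (b : {μ : σ →₀ ℕ // μ.degree = t}) : coeffVec t p b = p.coeff b.1 := rfl

theorem eq_of_coeffVec_eq {σ K : Type*} [CommRing K] {t : ℕ} {p q : MvPolynomial σ K}
    (hp : p.IsHomogeneous t) (hq : q.IsHomogeneous t) (h : coeffVec t p = coeffVec t q) :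
    p = q := by
  ext μ
  by_cases hμ : μ.degree = t
  · exact congrFun h ⟨μ, hμ⟩
  · rw [hp.coeff_eq_zero hμ, hq.coeff_eq_zero hμ]

theorem exists_isHomogeneous_coeffVec_eq {σ K : Type*} [Finite σ] [CommRing K] {t : ℕ}
    (y : {μ : σ →₀ ℕ // μ.degree = t} → K) :
    ∃ p : MvPolynomial σ K, p.IsHomogeneous t ∧ coeffVec t p = y := by
  classical
  have := Fintype.ofFinite {μ : σ →₀ ℕ // μ.degree = t}
  refine ⟨∑ b : {μ : σ →₀ ℕ // μ.degree = t}, monomial b.1 (y b),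
    IsHomogeneous.sum _ _ _ fun b _ => isHomogeneous_monomial _ b.2, ?_⟩
  funext b
  rw [coeffVec_apply, coeff_sum, Finset.sum_eq_single b]
  · simp
  · intro c _ hc
    rw [coeff_monomial, if_neg fun h => hc (Subtype.ext h)]
  · simp

theorem containsForms_span_iff {σ ι K : Type*} [Finite σ] [Field K]
    (φ : ι → MvPolynomial σ K) (e : ι → ℕ) (hφ : ∀ i, (φ i).IsHomogeneous (e i)) (t : ℕ) :
    ContainsForms (Ideal.span (Set.range φ)) t ↔
      Submodule.span K (Set.range fun p : {p : ι × (σ →₀ ℕ) // p.2.degree + e p.1 = t} =>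
        coeffVec t (monomial p.1.2 (1 : K) * φ p.1.1)) = ⊤ := by
  have hr : (Set.range fun p : {p : ι × (σ →₀ ℕ) // p.2.degree + e p.1 = t} =>
        coeffVec t (monomial p.1.2 (1 : K) * φ p.1.1)) = coeffVec t '' (Set.range
        fun p : {p : ι × (σ →₀ ℕ) // p.2.degree + e p.1 = t} =>
          monomial p.1.2 (1 : K) * φ p.1.1) := by
    rw [← Set.range_comp]; rfl
  rw [hr, ← Submodule.map_span]
  constructor
  · intro h
    rw [eq_top_iff]
    intro y _
    obtain ⟨p, hp, rfl⟩ := exists_isHomogeneous_coeffVec_eq y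
    refine ⟨p, ?_, rfl⟩
    have := homogeneousComponent_mem_span_monomial_mul φ e hφ t (h p hp)
    rwa [homogeneousComponent_eq_self hp] at this
  · intro h p hp
    have : coeffVec t p ∈ (⊤ : Submodule K _) := trivial
    rw [← h] at this
    obtain ⟨q, hq, hqp⟩ := this
    have hq' : q.IsHomogeneous t := by
      refine (Submodule.span_le (p := homogeneousSubmodule σ K t)).2 ?_ hq
      rintro _ ⟨⟨⟨i, w⟩, hw⟩, rfl⟩
      simp only at hw
      subst hw
      exact (isHomogeneous_monomial _ rfl).mul (hφ i)
    rw [← eq_of_coeffVec_eq hq' hp hqp, mem_ideal_span_iff_mem_span_monomial_mul]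
    refine Submodule.span_mono ?_ hq
    rintro _ ⟨p, rfl⟩
    exact ⟨p.1, rfl⟩

theorem coeffVec_monomial_mul_map {σ S L : Type*} [CommRing S] [CommRing L] (ev : S →+* L)
    (t : ℕ) (w : σ →₀ ℕ) (φ : MvPolynomial σ S) :
    coeffVec t (monomial w (1 : L) * map ev φ) =
      fun b => ev (coeffVec t (monomial w (1 : S) * φ) b) := by
  funext b
  rw [coeffVec_apply, coeffVec_apply, ← coeff_map, map_mul, map_monomial, map_one ev]

/-- Containing all forms of degree `t` is an open condition on the generators. -/
theorem ContainsForms.exists_open {σ ι S L₀ : Type*} [Finite σ] [CommRing S] [Field L₀]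
    (φ : ι → MvPolynomial σ S) (e : ι → ℕ) (hφ : ∀ i, (φ i).IsHomogeneous (e i)) (t : ℕ)
    (ev₀ : S →+* L₀)
    (h : ContainsForms (Ideal.span (Set.range fun i => map ev₀ (φ i))) t) :
    ∃ G : S, ev₀ G ≠ 0 ∧ ∀ {L : Type*} [Field L] (ev : S →+* L), ev G ≠ 0 →
      ContainsForms (Ideal.span (Set.range fun i => map ev (φ i))) t := by
  rw [containsForms_span_iff _ e fun i => (hφ i).map ev₀] at h
  simp only [coeffVec_monomial_mul_map] at h
  obtain ⟨G, hG, hG'⟩ := exists_minor_of_span_eq_top _ ev₀ h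
  refine ⟨G, hG, fun {L} _ ev hev => ?_⟩
  rw [containsForms_span_iff _ e fun i => (hφ i).map ev]
  simp only [coeffVec_monomial_mul_map]
  exact hG' ev hev

theorem containsForms_of_monomial_mem {σ K : Type*} [CommRing K] {I : Ideal (MvPolynomial σ K)}
    {t : ℕ} (h : ∀ μ : σ →₀ ℕ, μ.degree = t → monomial μ (1 : K) ∈ I) : ContainsForms I t := by
  intro p hp
  rw [p.as_sum]
  refine Ideal.sum_mem _ fun μ hμ => ?_
  have : monomial μ (p.coeff μ) = C (p.coeff μ) * monomial μ (1 : K) := by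
    rw [C_mul_monomial, mul_one]
  rw [this]
  refine Ideal.mul_mem_left _ _ (h μ ?_)
  by_contra hne
  exact (mem_support_iff.1 hμ) (hp.coeff_eq_zero hne)

theorem ContainsForms.mono {σ K : Type*} [CommRing K] {I J : Ideal (MvPolynomial σ K)} {t : ℕ}
    (h : ContainsForms I t) (hIJ : I ≤ J) : ContainsForms J t :=
  fun p hp => hIJ (h p hp)

/-- The linear form with coefficient vector `P (x, ·)`. -/
noncomputable def linForm {τ A : Type*} [CommRing A] {m : ℕ} (P : τ × Fin m → A) (x : τ) :
    MvPolynomial (Fin m) A := ∑ j, C (P (x, j)) * X j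

/-- The product of the linear forms of a given colour. -/
noncomputable def colorProd {τ ι A : Type*} [CommRing A] [DecidableEq ι] {m : ℕ} (T : Finset τ)
    (c : τ → ι) (P : τ × Fin m → A) (i : ι) : MvPolynomial (Fin m) A :=
  ∏ x ∈ T with c x = i, linForm P x

/-- The `a`-th power of the last variable together with the products of linear forms of each
colour. -/
noncomputable def colorGens {τ ι A : Type*} [CommRing A] [DecidableEq ι] {m : ℕ} (a : ℕ)
    (T : Finset τ) (c : τ → ι) (P : τ × Fin (m + 1) → A) :
    Option ι → MvPolynomial (Fin (m + 1)) A
  | none => X (Fin.last m) ^ a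
  | some i => colorProd T c P i

theorem linForm_isHomogeneous {τ A : Type*} [CommRing A] {m : ℕ} (P : τ × Fin m → A) (x : τ) :
    (linForm P x).IsHomogeneous 1 :=
  IsHomogeneous.sum _ _ _ fun _ _ => isHomogeneous_C_mul_X _ _

theorem colorProd_isHomogeneous {τ ι A : Type*} [CommRing A] [DecidableEq ι] {m : ℕ}
    (T : Finset τ) (c : τ → ι) (P : τ × Fin m → A) (i : ι) :
    (colorProd T c P i).IsHomogeneous (T.filter fun x => c x = i).card := by
  have := IsHomogeneous.prod (T.filter fun x => c x = i) (linForm P) (fun _ => 1)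
    fun x _ => linForm_isHomogeneous P x
  rwa [Finset.sum_const, smul_eq_mul, mul_one] at this

/-- The degrees of the forms in `colorGens`. -/
def colorDeg {τ ι : Type*} [DecidableEq ι] (a : ℕ) (T : Finset τ) (c : τ → ι) : Option ι → ℕ
  | none => a
  | some i => (T.filter fun x => c x = i).card

theorem colorGens_isHomogeneous {τ ι A : Type*} [CommRing A] [DecidableEq ι] {m : ℕ} (a : ℕ)
    (T : Finset τ) (c : τ → ι) (P : τ × Fin (m + 1) → A) (o : Option ι) :
    (colorGens a T c P o).IsHomogeneous (colorDeg a T c o) := by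
  cases o with
  | none => exact isHomogeneous_X_pow _ _
  | some i => exact colorProd_isHomogeneous T c P i

theorem map_linForm {τ A B : Type*} [CommRing A] [CommRing B] {m : ℕ} (ev : A →+* B)
    (P : τ × Fin m → A) (x : τ) : map ev (linForm P x) = linForm (fun y => ev (P y)) x := by
  simp [linForm]

theorem map_colorProd {τ ι A B : Type*} [CommRing A] [CommRing B] [DecidableEq ι] {m : ℕ}
    (ev : A →+* B) (T : Finset τ) (c : τ → ι) (P : τ × Fin m → A) (i : ι) :
    map ev (colorProd T c P i) = colorProd T c (fun y => ev (P y)) i := by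
  simp [colorProd, map_linForm]

theorem map_colorGens {τ ι A B : Type*} [CommRing A] [CommRing B] [DecidableEq ι] {m : ℕ}
    (ev : A →+* B) (a : ℕ) (T : Finset τ) (c : τ → ι) (P : τ × Fin (m + 1) → A) (o : Option ι) :
    map ev (colorGens a T c P o) = colorGens a T c (fun y => ev (P y)) o := by
  cases o with
  | none => simp [colorGens]
  | some i => exact map_colorProd ev T c P i

theorem exists_open_colorGens {τ ι K : Type*} [Field K] [DecidableEq ι] {m : ℕ} (a t : ℕ)
    (T : Finset τ) (c : τ → ι) (P₀ : τ × Fin (m + 1) → K)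
    (h : ContainsForms (Ideal.span (Set.range (colorGens a T c P₀))) t) :
    ∃ G : MvPolynomial (τ × Fin (m + 1)) K, G ≠ 0 ∧ ∀ P, eval P G ≠ 0 →
      ContainsForms (Ideal.span (Set.range (colorGens a T c P))) t := by
  have key : ∀ P : τ × Fin (m + 1) → K, (fun o => map (eval P) (colorGens a T c
      (fun y => (X y : MvPolynomial (τ × Fin (m + 1)) K)) o)) = colorGens a T c P := by
    intro P
    funext o
    rw [map_colorGens]
    simp
  obtain ⟨G, hG, hG'⟩ := ContainsForms.exists_open
    (colorGens a T c (fun y => (X y : MvPolynomial (τ × Fin (m + 1)) K))) (colorDeg a T c)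
    (colorGens_isHomogeneous a T c _) t (eval P₀) (by rw [key]; exact h)
  refine ⟨G, fun h0 => hG (by rw [h0, map_zero]), fun P hP => ?_⟩
  have := hG' (eval P) hP
  rwa [key] at this

/-- The projection setting the first variable to zero. -/
noncomputable def dropFirst (K : Type*) [CommRing K] (m : ℕ) :
    MvPolynomial (Fin (m + 1)) K →ₐ[K] MvPolynomial (Fin m) K :=
  aeval (Fin.cases 0 X)

theorem dropFirst_rename_succ {K : Type*} [CommRing K] {m : ℕ} (p : MvPolynomial (Fin m) K) :
    dropFirst K m (rename Fin.succ p) = p := by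
  rw [dropFirst, aeval_rename]
  have : (Fin.cases 0 X : Fin (m + 1) → MvPolynomial (Fin m) K) ∘ Fin.succ = X := by
    funext j; simp
  rw [this, aeval_X_left_apply]

theorem sub_rename_dropFirst_mem {K : Type*} [CommRing K] {m : ℕ}
    (p : MvPolynomial (Fin (m + 1)) K) :
    p - rename Fin.succ (dropFirst K m p) ∈
      Ideal.span (Set.range fun _ : Unit => (X 0 : MvPolynomial (Fin (m + 1)) K)) := by
  rw [← Ideal.Quotient.eq_zero_iff_mem, map_sub, sub_eq_zero]
  let I := Ideal.span (Set.range fun _ : Unit => (X 0 : MvPolynomial (Fin (m + 1)) K))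
  have : Ideal.Quotient.mkₐ K I = ((Ideal.Quotient.mkₐ K I).comp (rename Fin.succ)).comp
      (dropFirst K m) := by
    apply MvPolynomial.algHom_ext
    intro i
    refine Fin.cases ?_ (fun j => ?_) i
    · simp only [dropFirst, AlgHom.comp_apply, aeval_X, Fin.cases_zero, map_zero]
      exact Ideal.Quotient.eq_zero_iff_mem.2 (Ideal.subset_span ⟨(), rfl⟩)
    · simp [dropFirst]
  exact DFunLike.congr_fun this p

theorem dropFirst_isHomogeneous {K : Type*} [CommRing K] {m t : ℕ}
    {p : MvPolynomial (Fin (m + 1)) K} (hp : p.IsHomogeneous t) :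
    (dropFirst K m p).IsHomogeneous t := by
  have := hp.aeval (Fin.cases 0 X : Fin (m + 1) → MvPolynomial (Fin m) K) (n := 1) (by
    intro i
    refine Fin.cases ?_ (fun j => ?_) i
    · exact isHomogeneous_zero _ _ _
    · exact isHomogeneous_X _ _)
  simpa [dropFirst] using this

/-- If `I` contains all forms of degree `t + 1` modulo the first variable and the colon ideal
of `I` by the first variable contains all forms of degree `t`, then `I` contains all forms of
degree `t + 1`. -/
theorem containsForms_of_dropFirst {K ι : Type*} [Field K] {m t : ℕ}
    (φ : ι → MvPolynomial (Fin (m + 1)) K) (e : ι → ℕ) (hφ : ∀ i, (φ i).IsHomogeneous (e i))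
    (I J : Ideal (MvPolynomial (Fin (m + 1)) K)) (hφI : ∀ i, φ i ∈ I)
    (hJI : ∀ p ∈ J, X 0 * p ∈ I) (hJ : ContainsForms J t)
    (hdrop : ContainsForms (Ideal.span (Set.range fun i => dropFirst K m (φ i))) (t + 1)) :
    ContainsForms I (t + 1) := by
  intro h hh
  have h1 := hdrop _ (dropFirst_isHomogeneous hh)
  have h2 : Ideal.span (Set.range fun i => dropFirst K m (φ i)) =
      (Ideal.span (Set.range φ)).map (dropFirst K m) := by
    rw [Ideal.map_span, ← Set.range_comp]; rfl
  rw [h2, Ideal.mem_map_iff_of_surjective _ fun p => ⟨_, dropFirst_rename_succ p⟩] at h1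
  obtain ⟨q, hq, hqh⟩ := h1
  have h3 : h - q ∈
      Ideal.span (Set.range fun _ : Unit => (X 0 : MvPolynomial (Fin (m + 1)) K)) := by
    have := sub_rename_dropFirst_mem (h - q)
    rwa [map_sub, hqh, sub_self, map_zero, sub_zero] at this
  have h4 := homogeneousComponent_mem_span_monomial_mul _ e hφ (t + 1) hq
  have h5 := homogeneousComponent_mem_span_monomial_mul _ (fun _ => 1)
    (fun _ => isHomogeneous_X _ _) (t + 1) h3
  have h6 : h = homogeneousComponent (t + 1) q + homogeneousComponent (t + 1) (h - q) := by
    rw [← map_add, add_sub_cancel, homogeneousComponent_eq_self hh]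
  rw [h6]
  refine add_mem ?_ ?_
  · refine (Submodule.span_le (p := I.restrictScalars K)).2 ?_ h4
    rintro _ ⟨⟨⟨i, w⟩, hw⟩, rfl⟩
    exact I.mul_mem_left _ (hφI i)
  · refine (Submodule.span_le (p := I.restrictScalars K)).2 ?_ h5
    rintro _ ⟨⟨⟨i, w⟩, hw⟩, rfl⟩
    simp only at hw
    have := hJI _ (hJ (monomial w 1) (isHomogeneous_monomial _ (by omega)))
    rwa [mul_comm] at this

theorem dropFirst_linForm {τ K : Type*} [CommRing K] {m : ℕ} (P : τ × Fin (m + 1) → K) (x : τ) :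
    dropFirst K m (linForm P x) = linForm (fun y => P (y.1, y.2.succ)) x := by
  simp [linForm, dropFirst, Fin.sum_univ_succ, algHom_C]

theorem dropFirst_colorGens {τ ι K : Type*} [CommRing K] [DecidableEq ι] {m : ℕ} (a : ℕ)
    (T : Finset τ) (c : τ → ι) (P : τ × Fin (m + 2) → K) (o : Option ι) :
    dropFirst K (m + 1) (colorGens a T c P o) =
      colorGens a T c (fun y => P (y.1, y.2.succ)) o := by
  cases o with
  | none =>
    simp only [colorGens, map_pow]
    rw [← Fin.succ_last, dropFirst, aeval_X, Fin.cases_succ]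
  | some i => simp [colorGens, colorProd, dropFirst_linForm]

/-- Deform the linear forms with index `u` and `v` to `x` and `x + ε ℓ_v`, where `x` is the first
variable. -/
def collide {τ A : Type*} [CommRing A] [DecidableEq τ] {m : ℕ} (u v : τ) (ε : A)
    (P : τ × Fin (m + 1) → A) (y : τ × Fin (m + 1)) : A :=
  if y.1 = u then (if y.2 = 0 then 1 else 0)
  else if y.1 = v then (if y.2 = 0 then 1 else 0) + ε * P y else P y

section collide

variable {τ A : Type*} [CommRing A] [DecidableEq τ] {m : ℕ} {u v : τ}

theorem linForm_collide_left (ε : A) (P : τ × Fin (m + 1) → A) :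
    linForm (collide u v ε P) u = X 0 := by
  simp [linForm, collide]

theorem linForm_collide_right (huv : u ≠ v) (ε : A) (P : τ × Fin (m + 1) → A) :
    linForm (collide u v ε P) v = X 0 + C ε * linForm P v := by
  simp [linForm, collide, huv.symm, add_mul, Finset.sum_add_distrib, Finset.mul_sum, mul_assoc]

theorem linForm_collide_of_ne (ε : A) (P : τ × Fin (m + 1) → A) {x : τ} (hu : x ≠ u)
    (hv : x ≠ v) : linForm (collide u v ε P) x = linForm P x := by
  simp [linForm, collide, hu, hv]

theorem map_collide {B : Type*} [CommRing B] (f : A →+* B) (ε : A) (P : τ × Fin (m + 1) → A) :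
    (fun y => f (collide u v ε P y)) = collide u v (f ε) fun y => f (P y) := by
  funext y
  simp only [collide]
  split_ifs <;> simp

end collide

/-- Merge the colours `0` and `1`. -/
def mergeColor {m : ℕ} : Fin (m + 2) → Fin (m + 1) := Fin.cases 0 id

section colors

variable {τ A : Type*} [CommRing A] [DecidableEq τ] {m k : ℕ} {T : Finset τ}
  {c : τ → Fin (m + 2)} {u v : τ}

theorem colorProd_erase (hu : u ∈ T) (P : τ × Fin k → A) :
    colorProd T c P (c u) = linForm P u * colorProd (T.erase u) c P (c u) := by
  unfold colorProd
  rw [← Finset.mul_prod_erase (T.filter fun x => c x = c u) _ (a := u) (by simp [hu])]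
  congr 1
  refine Finset.prod_congr ?_ fun _ _ => rfl
  ext x; simp only [Finset.mem_erase, Finset.mem_filter]; tauto

theorem colorProd_erase_of_ne {i : Fin (m + 2)} (hi : c u ≠ i) (P : τ × Fin k → A) :
    colorProd (T.erase u) c P i = colorProd T c P i := by
  unfold colorProd
  refine Finset.prod_congr ?_ fun _ _ => rfl
  ext x; simp only [Finset.mem_erase, Finset.mem_filter]
  constructor
  · tauto
  · rintro ⟨h1, h2⟩
    exact ⟨⟨fun h => hi (h ▸ h2), h1⟩, h2⟩

theorem colorProd_merge_zero (P : τ × Fin k → A) :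
    colorProd T (mergeColor ∘ c) P 0 = colorProd T c P 0 * colorProd T c P 1 := by
  unfold colorProd
  rw [← Finset.prod_union]
  · refine Finset.prod_congr ?_ fun _ _ => rfl
    ext x
    rw [Finset.mem_filter, Finset.mem_union, Finset.mem_filter, Finset.mem_filter, ← and_or_left]
    refine and_congr_right fun _ => ?_
    rw [Function.comp_apply, mergeColor]
    refine Fin.cases (by simp) (fun j => ?_) (c x)
    rw [Fin.cases_succ, id, ← Fin.succ_zero_eq_one, Fin.succ_inj]
    simp [Fin.succ_ne_zero]
  · rw [Finset.disjoint_left]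
    intro x hx hx'
    simp only [Finset.mem_filter] at hx hx'
    exact absurd (hx.2.symm.trans hx'.2) (by simp)

theorem colorProd_merge_succ (P : τ × Fin k → A) (j : Fin m) :
    colorProd T (mergeColor ∘ c) P j.succ = colorProd T c P j.succ.succ := by
  unfold colorProd
  refine Finset.prod_congr ?_ fun _ _ => rfl
  ext x
  rw [Finset.mem_filter, Finset.mem_filter]
  refine and_congr_right fun _ => ?_
  rw [Function.comp_apply, mergeColor]
  refine Fin.cases ?_ (fun j => ?_) (c x)
  · rw [Fin.cases_zero]
    simp [Fin.ext_iff]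
  · rw [Fin.cases_succ, id, Fin.succ_inj]

theorem colorProd_collide (ε : A) (P : τ × Fin (k + 1) → A) (hu : u ∉ T) (hv : v ∉ T)
    (i : Fin (m + 2)) : colorProd T c (collide u v ε P) i = colorProd T c P i := by
  unfold colorProd
  refine Finset.prod_congr rfl fun x hx => ?_
  rw [Finset.mem_filter] at hx
  exact linForm_collide_of_ne _ _ (fun h => hu (h ▸ hx.1)) fun h => hv (h ▸ hx.1)

theorem colorProd_collide_zero (hu : u ∈ T) (hcu : c u = 0) (hcv : c v = 1) (ε : A)
    (P : τ × Fin (k + 1) → A) : colorProd T c (collide u v ε P) 0 =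
      X 0 * colorProd ((T.erase u).erase v) c P 0 := by
  have := colorProd_erase (c := c) hu (collide u v ε P)
  rw [hcu, linForm_collide_left,
    ← colorProd_erase_of_ne (T := T.erase u) (u := v) (i := 0) (by simp [hcv]),
    colorProd_collide (T := (T.erase u).erase v) _ _ (by simp) (by simp)] at this
  exact this

theorem colorProd_collide_one (huv : u ≠ v) (hv : v ∈ T) (hcu : c u = 0) (hcv : c v = 1) (ε : A)
    (P : τ × Fin (k + 1) → A) : colorProd T c (collide u v ε P) 1 =
      (X 0 + C ε * linForm P v) * colorProd ((T.erase u).erase v) c P 1 := by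
  have := colorProd_erase (c := c) (Finset.mem_erase.2 ⟨huv.symm, hv⟩) (collide u v ε P)
  rw [hcv, linForm_collide_right huv,
    colorProd_collide (T := (T.erase u).erase v) _ _ (by simp) (by simp),
    colorProd_erase_of_ne (by simp [hcu])] at this
  exact this

theorem colorProd_collide_succ_succ (hcu : c u = 0) (hcv : c v = 1) (ε : A)
    (P : τ × Fin (k + 1) → A) (j : Fin m) : colorProd T c (collide u v ε P) j.succ.succ =
      colorProd ((T.erase u).erase v) c P j.succ.succ := by
  rw [← colorProd_collide (c := c) (u := u) (v := v) ε P (by simp) (by simp),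
    colorProd_erase_of_ne, colorProd_erase_of_ne]
  · rw [hcu]; exact (Fin.succ_ne_zero _).symm
  · rw [hcv, ← Fin.succ_zero_eq_one]
    exact fun h => (Fin.succ_ne_zero _).symm (Fin.succ_injective _ h)

theorem colorProd_erase_merge_zero (huv : u ≠ v) (hv : v ∈ T) (hcv : c v = 1)
    (P : τ × Fin k → A) : colorProd (T.erase u) (mergeColor ∘ c) P 0 =
      linForm P v * (colorProd ((T.erase u).erase v) c P 0 *
        colorProd ((T.erase u).erase v) c P 1) := by
  rw [colorProd_merge_zero, ← hcv, colorProd_erase (Finset.mem_erase.2 ⟨huv.symm, hv⟩), hcv,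
    ← colorProd_erase_of_ne (T := T.erase u) (u := v) (i := 0) (by simp [hcv])]
  ring

theorem colorProd_erase_merge_succ (hcv : c v = 1) (P : τ × Fin k → A) (j : Fin m) :
    colorProd (T.erase u) (mergeColor ∘ c) P j.succ =
      colorProd ((T.erase u).erase v) c P j.succ.succ := by
  rw [colorProd_merge_succ, colorProd_erase_of_ne (u := v)]
  rw [hcv, ← Fin.succ_zero_eq_one]
  exact fun h => (Fin.succ_ne_zero _).symm (Fin.succ_injective _ h)

end colors

theorem containsForms_of_one_mem {σ K : Type*} [CommRing K] {I : Ideal (MvPolynomial σ K)}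
    (h : (1 : MvPolynomial σ K) ∈ I) (t : ℕ) : ContainsForms I t := fun p _ => by
  rw [(Ideal.eq_top_iff_one I).2 h]; trivial


/-- Existence of a choice of linear forms for the inductive step. -/
theorem exists_collide {τ K : Type*} [Field K] [Infinite K] [DecidableEq τ] {m a t : ℕ}
    {T : Finset τ} {c : τ → Fin (m + 2)} {u v : τ} (hu : u ∈ T) (hv : v ∈ T) (hcu : c u = 0)
    (hcv : c v = 1) (P : τ × Fin (m + 2) → K)
    (h1 : ContainsForms (Ideal.span (Set.range
      (colorGens a (T.erase u) (mergeColor ∘ c) fun y => P (y.1, y.2.succ)))) (t + 1))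
    (h2 : ContainsForms (Ideal.span (Set.range (colorGens a ((T.erase u).erase v) c P))) t) :
    ∃ P' : τ × Fin (m + 2) → K,
      ContainsForms (Ideal.span (Set.range (colorGens a T c P'))) (t + 1) := by
  have huv : u ≠ v := by rintro rfl; rw [hcu] at hcv; simp at hcv
  let ψ : Option (Fin (m + 2)) ⊕ Option (Fin (m + 1)) →
      MvPolynomial (Fin (m + 2)) (Polynomial K) :=
    Sum.elim (colorGens a T c (collide u v Polynomial.X fun y => Polynomial.C (P y)))
      (colorGens a (T.erase u) (mergeColor ∘ c) fun y => Polynomial.C (P y))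
  let e : Option (Fin (m + 2)) ⊕ Option (Fin (m + 1)) → ℕ :=
    Sum.elim (colorDeg a T c) (colorDeg a (T.erase u) (mergeColor ∘ c))
  have hψ : ∀ o, (ψ o).IsHomogeneous (e o) := by
    rintro (o | o)
    · exact colorGens_isHomogeneous _ _ _ _ _
    · exact colorGens_isHomogeneous _ _ _ _ _
  have hψev : ∀ ε : K, (fun o => map (Polynomial.evalRingHom ε) (ψ o)) =
      Sum.elim (colorGens a T c (collide u v ε P))
        (colorGens a (T.erase u) (mergeColor ∘ c) P) := by
    intro ε
    funext o
    rcases o with o | o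
    · simp only [ψ, Sum.elim_inl]
      rw [map_colorGens, map_collide]
      simp
    · simp only [ψ, Sum.elim_inr]
      rw [map_colorGens]
      simp
  have h0 : ContainsForms (Ideal.span (Set.range fun o =>
      map (Polynomial.evalRingHom (0 : K)) (ψ o))) (t + 1) := by
    rw [hψev]
    set I := Ideal.span (Set.range (Sum.elim (colorGens a T c (collide u v 0 P))
        (colorGens a (T.erase u) (mergeColor ∘ c) P))) with hI
    have hl : ∀ o, colorGens a T c (collide u v 0 P) o ∈ I :=
      fun o => Ideal.subset_span ⟨Sum.inl o, rfl⟩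
    refine containsForms_of_dropFirst (colorGens a (T.erase u) (mergeColor ∘ c) P) _
      (colorGens_isHomogeneous _ _ _ _) I _
      (fun o => Ideal.subset_span ⟨Sum.inr o, rfl⟩) ?_ h2 ?_
    · intro p hp
      refine Submodule.span_induction (p := fun p _ => X 0 * p ∈ I) ?_ (by simp) ?_ ?_ hp
      · rintro _ ⟨o, rfl⟩
        rcases o with - | j
        · exact I.mul_mem_left _ (hl none)
        refine Fin.cases ?_ (fun j => Fin.cases ?_ (fun j => ?_) j) j
        · have := hl (some 0)
          simp only [colorGens] at this
          rwa [colorProd_collide_zero hu hcu hcv] at this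
        · have := hl (some 1)
          simp only [colorGens] at this
          rwa [colorProd_collide_one huv hv hcu hcv, C_0, zero_mul, add_zero] at this
        · have := hl (some j.succ.succ)
          simp only [colorGens] at this
          rw [colorProd_collide_succ_succ hcu hcv] at this
          exact I.mul_mem_left _ this
      · intro x y _ _ hx hy
        rw [mul_add]
        exact add_mem hx hy
      · intro r x _ hx
        rw [smul_eq_mul, mul_left_comm]
        exact I.mul_mem_left _ hx
    · simp only [dropFirst_colorGens]
      exact h1
  obtain ⟨G, hG, hG'⟩ := ContainsForms.exists_open ψ e hψ (t + 1) _ h0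
  have hGX : G * Polynomial.X ≠ 0 :=
    mul_ne_zero (fun h => hG (by rw [h, map_zero])) Polynomial.X_ne_zero
  obtain ⟨ε, hε⟩ : ∃ ε : K, Polynomial.eval ε (G * Polynomial.X) ≠ 0 := by
    by_contra! h
    exact hGX (Polynomial.funext fun r => by rw [h r, Polynomial.eval_zero])
  rw [Polynomial.eval_mul, Polynomial.eval_X] at hε
  refine ⟨collide u v ε P, ?_⟩
  have h3 := hG' (Polynomial.evalRingHom ε) (left_ne_zero_of_mul hε)
  rw [hψev] at h3
  refine h3.mono ?_
  set I := Ideal.span (Set.range (colorGens a T c (collide u v ε P))) with hI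
  have hl : ∀ o, colorGens a T c (collide u v ε P) o ∈ I :=
    fun o => Ideal.subset_span ⟨o, rfl⟩
  rw [Ideal.span_le]
  rintro _ ⟨o | o, rfl⟩
  · exact hl o
  rcases o with - | j
  · exact hl none
  refine Fin.cases ?_ (fun j => ?_) j
  · show colorProd (T.erase u) (mergeColor ∘ c) P 0 ∈ I
    have e0 : X 0 * colorProd ((T.erase u).erase v) c P 0 ∈ I := by
      rw [← colorProd_collide_zero hu hcu hcv ε P]; exact hl (some 0)
    have e1 : (X 0 + C ε * linForm P v) * colorProd ((T.erase u).erase v) c P 1 ∈ I := by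
      rw [← colorProd_collide_one huv hv hcu hcv ε P]; exact hl (some 1)
    rw [colorProd_erase_merge_zero huv hv hcv]
    have e2 : (C ε⁻¹ * C ε : MvPolynomial (Fin (m + 2)) K) = 1 := by
      rw [← C_mul, inv_mul_cancel₀ (right_ne_zero_of_mul hε), C_1]
    have := I.mul_mem_left (C ε⁻¹) (sub_mem (I.mul_mem_left (colorProd ((T.erase u).erase v) c P 0) e1)
      (I.mul_mem_left (colorProd ((T.erase u).erase v) c P 1) e0))
    convert this using 1
    linear_combination (-(linForm P v * (colorProd ((T.erase u).erase v) c P 0 *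
        colorProd ((T.erase u).erase v) c P 1))) * e2
  · show colorProd (T.erase u) (mergeColor ∘ c) P j.succ ∈ I
    rw [colorProd_erase_merge_succ hcv, ← colorProd_collide_succ_succ hcu hcv ε P]
    exact hl (some j.succ.succ)

theorem exists_eval_ne_zero {σ K : Type*} [Field K] [Infinite K] {p : MvPolynomial σ K}
    (hp : p ≠ 0) : ∃ x : σ → K, eval x p ≠ 0 := by
  by_contra! h
  exact hp (MvPolynomial.funext fun x => by rw [h x, map_zero])

/-- General products of linear forms `f_i` of `m + 1` colours, together with the power `z ^ a`,
generate all forms of degree `t` as soon as `t` is at least half of `∑ deg f_i + a - (m + 1)`. -/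
theorem containsForms_colorGens {τ K : Type*} [Field K] [Infinite K] [DecidableEq τ] :
    ∀ (s : ℕ) {m : ℕ} (a t : ℕ) (T : Finset τ) (c : τ → Fin (m + 1)), T.card = s →
      T.card + a ≤ 2 * t + (m + 1) →
      ∃ G : MvPolynomial (τ × Fin (m + 1)) K, G ≠ 0 ∧ ∀ P, eval P G ≠ 0 →
        ContainsForms (Ideal.span (Set.range (colorGens a T c P))) t := by
  intro s
  induction s using Nat.strong_induction_on with
  | _ s ih =>
  intro m a t T c hs hle
  by_cases hemp : ∃ i, ∀ x ∈ T, c x ≠ i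
  · obtain ⟨i, hi⟩ := hemp
    refine ⟨1, one_ne_zero, fun P _ => containsForms_of_one_mem ?_ t⟩
    refine Ideal.subset_span ⟨some i, ?_⟩
    simp only [colorGens, colorProd]
    rw [Finset.filter_false_of_mem hi, Finset.prod_empty]
  push Not at hemp
  have hcard : m + 1 ≤ T.card := by
    have := Finset.card_le_card (s := Finset.univ) (t := T.image c) fun i _ => by
      obtain ⟨x, hx, hxi⟩ := hemp i
      exact Finset.mem_image.2 ⟨x, hx, hxi⟩
    rw [Finset.card_univ, Fintype.card_fin] at this
    exact this.trans Finset.card_image_le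
  rcases m with - | m
  · have hsub : Subsingleton (Fin (0 + 1)) := inferInstanceAs (Subsingleton (Fin 1))
    refine exists_open_colorGens a t T c (fun _ => 1) (containsForms_of_monomial_mem fun μ hμ => ?_)
    set I := Ideal.span (Set.range (colorGens a T c fun _ => (1 : K))) with hI
    have hμ' : monomial μ (1 : K) = X 0 ^ t := by
      have : μ = Finsupp.single 0 t := by
        ext i
        rw [hsub.elim i 0, ← hμ, Finsupp.degree_eq_sum]
        simp
      rw [X_pow_eq_monomial, this]
    have h1 : (X 0 : MvPolynomial (Fin 1) K) ^ a ∈ I := Ideal.subset_span ⟨none, rfl⟩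
    have h2 : (X 0 : MvPolynomial (Fin 1) K) ^ T.card ∈ I := by
      refine Ideal.subset_span ⟨some 0, ?_⟩
      simp only [colorGens, colorProd]
      rw [Finset.filter_true_of_mem fun x _ => hsub.elim _ _]
      simp [linForm]
    rw [hμ']
    rcases le_or_gt a t with h | h
    · exact Ideal.mem_of_dvd _ (pow_dvd_pow _ h) h1
    · exact Ideal.mem_of_dvd _ (pow_dvd_pow _ (by omega)) h2
  rcases t with - | t
  · have : a = 0 := by omega
    subst this
    refine ⟨1, one_ne_zero, fun P _ => containsForms_of_one_mem ?_ _⟩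
    refine Ideal.subset_span ⟨none, ?_⟩
    simp [colorGens]
  obtain ⟨u, hu, hcu⟩ := hemp 0
  obtain ⟨v, hv, hcv⟩ := hemp 1
  have huv : u ≠ v := by rintro rfl; rw [hcu] at hcv; simp at hcv
  have hv' : v ∈ T.erase u := Finset.mem_erase.2 ⟨huv.symm, hv⟩
  have c1 := Finset.card_erase_of_mem hu
  have c2 := Finset.card_erase_of_mem hv'
  obtain ⟨G₁, hG₁, h₁⟩ := ih _ (by omega) a (t + 1) (T.erase u) (mergeColor ∘ c) rfl (by omega)
  obtain ⟨G₂, hG₂, h₂⟩ := ih _ (by omega) a t ((T.erase u).erase v) c rfl (by omega)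
  let s : τ × Fin (m + 1) → τ × Fin (m + 2) := fun y => (y.1, y.2.succ)
  have hs' : Function.Injective s := fun x y h => by
    simp only [s, Prod.mk.injEq, Fin.succ_inj] at h
    exact Prod.ext h.1 h.2
  have hG₁' : rename s G₁ ≠ 0 := (rename_injective s hs').ne_iff' (map_zero _) |>.2 hG₁
  obtain ⟨P, hP⟩ := exists_eval_ne_zero (mul_ne_zero hG₁' hG₂)
  rw [map_mul, eval_rename] at hP
  obtain ⟨P', hP'⟩ := exists_collide hu hv hcu hcv P (h₁ _ (left_ne_zero_of_mul hP))
    (h₂ _ (right_ne_zero_of_mul hP))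
  exact exists_open_colorGens a (t + 1) T c P' hP'

theorem expDeg_eq_degree {n : ℕ} (μ : Fin n →₀ ℕ) : expDeg μ = μ.degree := rfl

/-- The monomials in `W` span the forms of degree `t` modulo `I`. -/
def SpansForms {σ K : Type*} [CommRing K] (W : Set (σ →₀ ℕ)) (I : Ideal (MvPolynomial σ K))
    (t : ℕ) : Prop :=
  homogeneousSubmodule σ K t ≤
    Submodule.span K ((fun μ => monomial μ (1 : K)) '' W) ⊔ I.restrictScalars K

theorem SpansForms.of_monomial {σ K : Type*} [CommRing K] {W : Set (σ →₀ ℕ)}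
    {I : Ideal (MvPolynomial σ K)} {t : ℕ}
    (h : ∀ μ : σ →₀ ℕ, μ.degree = t → monomial μ (1 : K) ∈
      Submodule.span K ((fun μ => monomial μ (1 : K)) '' W) ⊔ I.restrictScalars K) :
    SpansForms W I t := by
  intro p hp
  rw [p.as_sum]
  refine Submodule.sum_mem _ fun μ hμ => ?_
  have : monomial μ (p.coeff μ) = p.coeff μ • monomial μ (1 : K) := by
    rw [smul_monomial, smul_eq_mul, mul_one]
  rw [this]
  refine Submodule.smul_mem _ _ (h μ ?_)
  by_contra hne
  exact (mem_support_iff.1 hμ) (((mem_homogeneousSubmodule _ _).1 hp).coeff_eq_zero hne)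

theorem spansForms_iff_containsForms {σ ι K : Type*} [CommRing K] {W : Set (σ →₀ ℕ)} {t : ℕ}
    (hW : ∀ μ ∈ W, μ.degree = t) (φ : ι → MvPolynomial σ K) (e : ι → ℕ)
    (hφ : ∀ i, (φ i).IsHomogeneous (e i)) :
    SpansForms W (Ideal.span (Set.range φ)) t ↔ ContainsForms (Ideal.span (Set.range
      (Sum.elim (fun μ : W => monomial μ.1 (1 : K)) φ))) t := by
  constructor
  · intro h p hp
    refine (?_ : _ ≤ (Ideal.span (Set.range
      (Sum.elim (fun μ : W => monomial μ.1 (1 : K)) φ))).restrictScalars K) (h hp)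
    refine sup_le (Submodule.span_le.2 ?_) ?_
    · rintro _ ⟨μ, hμ, rfl⟩
      exact Ideal.subset_span ⟨Sum.inl ⟨μ, hμ⟩, rfl⟩
    · refine Submodule.restrictScalars_mono (S := K) (Ideal.span_mono ?_)
      rintro _ ⟨i, rfl⟩
      exact ⟨Sum.inr i, rfl⟩
  · intro h p hp
    have h1 := homogeneousComponent_mem_span_monomial_mul _ (Sum.elim (fun _ => t) e)
      (by rintro (μ | i)
          · exact isHomogeneous_monomial _ (hW _ μ.2)
          · exact hφ i) t (h p hp)
    rw [homogeneousComponent_eq_self hp] at h1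
    refine Submodule.span_le.2 ?_ h1
    rintro _ ⟨⟨⟨μ | i, w⟩, hw⟩, rfl⟩
    · refine Submodule.mem_sup_left ?_
      have : w = 0 := by
        rw [← Finsupp.degree_eq_zero_iff]
        simpa using hw
      subst this
      refine Submodule.subset_span ⟨μ, μ.2, ?_⟩
      simp
    · refine Submodule.mem_sup_right ?_
      exact Ideal.mul_mem_left _ _ (Ideal.subset_span ⟨i, rfl⟩)

/-- The universal family of forms of degrees `d i`. -/
noncomputable def universalForm (F : Type*) [CommRing F] {n r : ℕ} (d : Fin r → ℕ) (i : Fin r) :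
    MvPolynomial (Fin n)
      (MvPolynomial (Σ i : Fin r, { μ : Fin n →₀ ℕ // expDeg μ = d i }) F) :=
  ∑ᶠ μ : { μ : Fin n →₀ ℕ // expDeg μ = d i }, monomial μ.1 (X ⟨i, μ⟩)

theorem coeff_universalForm (F : Type*) [CommRing F] {n r : ℕ} (d : Fin r → ℕ) (i : Fin r)
    (μ : { μ : Fin n →₀ ℕ // expDeg μ = d i }) :
    (universalForm F d i).coeff μ.1 = X ⟨i, μ⟩ := by
  have : Finite { μ : Fin n →₀ ℕ // expDeg μ = d i } := finite_degree_eq (σ := Fin n) (d i)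
  have := Fintype.ofFinite { μ : Fin n →₀ ℕ // expDeg μ = d i }
  rw [universalForm, finsum_eq_sum_of_fintype, coeff_sum, Finset.sum_eq_single μ]
  · simp
  · intro b _ hb
    rw [coeff_monomial, if_neg]
    exact fun h => hb (Subtype.ext h)
  · simp

theorem universalForm_isHomogeneous (F : Type*) [CommRing F] {n r : ℕ} (d : Fin r → ℕ)
    (i : Fin r) : (universalForm (n := n) F d i).IsHomogeneous (d i) := by
  have : Finite { μ : Fin n →₀ ℕ // expDeg μ = d i } := finite_degree_eq (σ := Fin n) (d i)
  have := Fintype.ofFinite { μ : Fin n →₀ ℕ // expDeg μ = d i }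
  rw [universalForm, finsum_eq_sum_of_fintype]
  exact IsHomogeneous.sum _ _ _ fun b _ => isHomogeneous_monomial _ b.2

theorem map_universalForm {F L : Type*} [CommRing F] [CommRing L] [Algebra F L] {n r : ℕ}
    (d : Fin r → ℕ) (f : Fin r → MvPolynomial (Fin n) L) (hf : ∀ i, (f i).IsHomogeneous (d i))
    (i : Fin r) : map (aeval (R := F)
      fun p : Σ i : Fin r, { μ : Fin n →₀ ℕ // expDeg μ = d i } => (f p.1).coeff p.2.1).toRingHom
        (universalForm F d i) = f i := by
  ext μ
  rw [coeff_map]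
  by_cases hμ : expDeg μ = d i
  · have := coeff_universalForm F d i ⟨μ, hμ⟩
    simp only at this
    rw [this]
    simp
  · rw [(universalForm_isHomogeneous F d i).coeff_eq_zero hμ, (hf i).coeff_eq_zero hμ, map_zero]

/-- If the monomials in `W` span modulo some forms `f₀` of the given degrees then they span modulo
generic ones. -/
theorem IsGenericSeq.spansForms {F K ι : Type*} [Field F] [Field K] [Algebra F K] {n r t : ℕ}
    {d : Fin r → ℕ} {f : Fin r → MvPolynomial (Fin n) K} (hf : IsGenericSeq F d f)
    {W : Set (Fin n →₀ ℕ)} (hW : ∀ μ ∈ W, μ.degree = t) (α : ι → Fin r)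
    (f₀ : Fin r → MvPolynomial (Fin n) K) (hf₀ : ∀ i, (f₀ i).IsHomogeneous (d i))
    (h : SpansForms W (Ideal.span (Set.range (f₀ ∘ α))) t) :
    SpansForms W (Ideal.span (Set.range (f ∘ α))) t := by
  rw [spansForms_iff_containsForms hW (f₀ ∘ α) _ fun i => hf₀ (α i)] at h
  rw [spansForms_iff_containsForms hW (f ∘ α) _ fun i => hf.1 (α i)]
  have key : ∀ f' : Fin r → MvPolynomial (Fin n) K, (∀ i, (f' i).IsHomogeneous (d i)) →
      (fun o => map (aeval (R := F) fun p : Σ i : Fin r, { μ : Fin n →₀ ℕ // expDeg μ = d i } =>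
        (f' p.1).coeff p.2.1).toRingHom
        (Sum.elim (fun μ : W => monomial μ.1 1) (universalForm F d ∘ α) o)) =
      Sum.elim (fun μ : W => monomial μ.1 (1 : K)) (f' ∘ α) := by
    intro f' hf'
    funext o
    rcases o with μ | i
    · simp
    · exact map_universalForm d f' hf' (α i)
  rw [← key f₀ hf₀] at h
  obtain ⟨G, hG, hG'⟩ := ContainsForms.exists_open _ (Sum.elim (fun _ => t) (d ∘ α))
    (by rintro (μ | i)
        · exact isHomogeneous_monomial _ (hW _ μ.2)
        · exact universalForm_isHomogeneous F d (α i)) t _ h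
  rw [← key f hf.1]
  refine hG' _ fun h0 => hG ?_
  rw [show G = 0 from hf.2 (h0.trans (map_zero _).symm), map_zero]

section embExp

variable {n : ℕ}

@[simp] theorem embExp_castSucc (ν : Fin n →₀ ℕ) (i : Fin n) : embExp ν i.castSucc = ν i :=
  Finsupp.embDomain_apply_self ⟨Fin.castSucc, Fin.castSucc_injective n⟩ ν i

@[simp] theorem embExp_last (ν : Fin n →₀ ℕ) : embExp ν (Fin.last n) = 0 := by
  refine Finsupp.embDomain_of_notMem_range _ _ _ ?_
  rintro ⟨i, hi⟩
  exact (Fin.castSucc_lt_last i).ne hi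

theorem embExp_injective : Function.Injective (embExp (n := n)) := fun a b h => by
  ext i
  rw [← embExp_castSucc, h, embExp_castSucc]

theorem expDeg_eq_sum (μ : Fin n →₀ ℕ) : expDeg μ = ∑ i, μ i :=
  Finsupp.sum_fintype _ _ fun _ => rfl

@[simp] theorem expDeg_embExp (ν : Fin n →₀ ℕ) : expDeg (embExp ν) = expDeg ν := by
  simp [expDeg_eq_sum, Fin.sum_univ_castSucc]

theorem exists_embExp_eq {μ : Fin (n + 1) →₀ ℕ} (h : μ (Fin.last n) = 0) :
    ∃ ν, embExp ν = μ := by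
  refine ⟨Finsupp.equivFunOnFinite.symm fun i => μ i.castSucc, ?_⟩
  ext i
  refine Fin.lastCases ?_ (fun j => ?_) i
  · rw [embExp_last, h]
  · rw [embExp_castSucc]; rfl

variable {K : Type*} [CommRing K]

theorem projMap_monomial_embExp (ν : Fin n →₀ ℕ) (a : K) :
    projMap K n (monomial (embExp ν) a) = monomial ν a := by
  rw [projMap, aeval_monomial, embExp, Finsupp.prod_embDomain]
  simp only [Function.Embedding.coeFn_mk, Fin.lastCases_castSucc]
  rw [monomial_eq]; rfl

theorem projMap_monomial_of_ne {μ : Fin (n + 1) →₀ ℕ} (h : μ (Fin.last n) ≠ 0) (a : K) :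
    projMap K n (monomial μ a) = 0 := by
  rw [projMap, aeval_monomial, Finsupp.prod, Finset.prod_eq_zero (i := Fin.last n), mul_zero]
  · exact Finsupp.mem_support_iff.2 h
  · rw [Fin.lastCases_last, zero_pow h]

theorem coeff_projMap (p : MvPolynomial (Fin (n + 1)) K) (ν : Fin n →₀ ℕ) :
    (projMap K n p).coeff ν = p.coeff (embExp ν) := by
  induction p using MvPolynomial.induction_on' with
  | monomial μ a =>
    by_cases h : μ (Fin.last n) = 0
    · obtain ⟨μ, rfl⟩ := exists_embExp_eq h
      rw [projMap_monomial_embExp, coeff_monomial, coeff_monomial]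
      simp only [embExp_injective.eq_iff]
    · rw [projMap_monomial_of_ne h, coeff_zero, coeff_monomial, if_neg]
      rintro rfl
      exact h (embExp_last ν)
  | add p q hp hq => rw [map_add, coeff_add, coeff_add, hp, hq]

theorem projMap_surjective : Function.Surjective (projMap K n) := fun q => by
  induction q using MvPolynomial.induction_on' with
  | monomial μ a => exact ⟨_, projMap_monomial_embExp μ a⟩
  | add p q hp hq =>
    obtain ⟨p, rfl⟩ := hp
    obtain ⟨q, rfl⟩ := hq
    exact ⟨p + q, map_add _ _ _⟩

theorem projMap_isHomogeneous {p : MvPolynomial (Fin (n + 1)) K} {t : ℕ} (hp : p.IsHomogeneous t) :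
    (projMap K n p).IsHomogeneous t := by
  intro ν hν
  rw [coeff_projMap] at hν
  by_contra h
  refine hν (hp.coeff_eq_zero fun h' => h ?_)
  have := DFunLike.congr_fun (Finsupp.degree_eq_weight_one (σ := Fin n) (R := ℕ)) ν
  exact this.symm.trans ((expDeg_embExp ν).symm.trans h')

end embExp

theorem IsGenericSeq.proj {F K : Type*} [CommRing F] [CommRing K] [Algebra F K] {n r : ℕ}
    {d : Fin r → ℕ} {f : Fin r → MvPolynomial (Fin (n + 1)) K} (hf : IsGenericSeq F d f) :
    IsGenericSeq F d fun i => projMap K n (f i) := by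
  refine ⟨fun i => projMap_isHomogeneous (hf.1 i), ?_⟩
  have := hf.2.comp (fun p : Σ i : Fin r, { μ : Fin n →₀ ℕ // expDeg μ = d i } =>
    (⟨p.1, embExp p.2.1, (expDeg_embExp _).trans p.2.2⟩ :
      Σ i : Fin r, { μ : Fin (n + 1) →₀ ℕ // expDeg μ = d i })) (by
    rintro ⟨i, μ, hμ⟩ ⟨j, ν, hν⟩ h
    simp only [Sigma.mk.injEq] at h
    obtain ⟨rfl, h⟩ := h
    rw [heq_eq_eq, Subtype.mk.injEq] at h
    obtain rfl := embExp_injective h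
    rfl)
  convert this using 2 with p
  exact coeff_projMap _ _

theorem IsGenericSeq.comp {F K : Type*} [CommRing F] [CommRing K] [Algebra F K] {n r s : ℕ}
    {d : Fin r → ℕ} {f : Fin r → MvPolynomial (Fin n) K} (hf : IsGenericSeq F d f)
    (α : Fin s → Fin r) (hα : Function.Injective α) :
    IsGenericSeq F (d ∘ α) (f ∘ α) := by
  refine ⟨fun i => hf.1 (α i), ?_⟩
  exact hf.2.comp (fun p : Σ i : Fin s, { μ : Fin n →₀ ℕ // expDeg μ = d (α i) } =>
    (⟨α p.1, p.2⟩ : Σ i : Fin r, { μ : Fin n →₀ ℕ // expDeg μ = d i })) (by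
    rintro ⟨i, μ⟩ ⟨j, ν⟩ h
    simp only [Sigma.mk.injEq] at h
    obtain ⟨h1, h⟩ := h
    obtain rfl := hα h1
    rw [heq_eq_eq] at h
    subst h
    rfl)

/-- Exponent vectors of degree `t` bounded by `d` in the first `r` coordinates. -/
def boxSet {n : ℕ} (d : Fin n → ℕ) (r t : ℕ) : Set (Fin n →₀ ℕ) :=
  { μ | μ.degree = t ∧ ∀ i : Fin n, i.val < r → μ i < d i }

/-- The monomials of `boxSet d r t` span the forms of degree `t` modulo the first `r` forms of a
generic sequence. -/
theorem IsGenericSeq.spansForms_boxSet {F K : Type*} [Field F] [Field K] [Algebra F K] {n : ℕ}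
    {d : Fin n → ℕ} {f : Fin n → MvPolynomial (Fin n) K} (hf : IsGenericSeq F d f) (r t : ℕ) :
    SpansForms (boxSet d r t)
      (Ideal.span (Set.range (f ∘ (Subtype.val : { i : Fin n // i.val < r } → Fin n)))) t := by
  refine hf.spansForms (fun μ hμ => hμ.1) _ (fun i => X i ^ d i)
    (fun i => isHomogeneous_X_pow _ _) (SpansForms.of_monomial fun μ hμ => ?_)
  by_cases h : ∀ i : Fin n, i.val < r → μ i < d i
  · exact Submodule.mem_sup_left (Submodule.subset_span ⟨μ, ⟨hμ, h⟩, rfl⟩)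
  · push Not at h
    obtain ⟨i, hi, hle⟩ := h
    refine Submodule.mem_sup_right ?_
    have : monomial μ (1 : K) = monomial (μ - Finsupp.single i (d i)) 1 * X i ^ d i := by
      rw [X_pow_eq_monomial, monomial_mul, one_mul, tsub_add_cancel_of_le]
      exact Finsupp.single_le_iff.2 hle
    rw [this]
    exact Ideal.mul_mem_left _ _ (Ideal.subset_span ⟨⟨i, hi⟩, rfl⟩)

/-- The strong Lefschetz property of the last variable modulo a generic complete intersection,
in the form of surjectivity of multiplication by `z ^ a` onto degree `t`. -/
theorem IsGenericSeq.spansForms_last {F K : Type*} [Field F] [Field K] [Algebra F K] [Infinite K]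
    {n : ℕ} {d : Fin (n + 1) → ℕ} {f : Fin (n + 1) → MvPolynomial (Fin (n + 1)) K}
    (hf : IsGenericSeq F d f) {a t : ℕ} (h : ∑ i, d i + a ≤ 2 * t + (n + 1)) :
    SpansForms { μ | μ.degree = t ∧ a ≤ μ (Fin.last n) } (Ideal.span (Set.range f)) t := by
  classical
  let c : (Σ i, Fin (d i)) → Fin (n + 1) := Sigma.fst
  have hc : ∀ i, (Finset.univ.filter fun x => c x = i).card = d i := by
    intro i
    have : (Finset.univ.filter fun x => c x = i) =
        Finset.univ.map (Function.Embedding.sigmaMk (β := fun i => Fin (d i)) i) := by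
      ext ⟨j, x⟩
      simp only [c, Finset.mem_filter, Finset.mem_univ, true_and, Finset.mem_map,
        Function.Embedding.sigmaMk_apply, Sigma.mk.injEq]
      constructor
      · rintro rfl
        exact ⟨x, rfl, HEq.rfl⟩
      · rintro ⟨x, rfl, -⟩
        rfl
    rw [this, Finset.card_map, Finset.card_univ, Fintype.card_fin]
  obtain ⟨G, hG, hG'⟩ := containsForms_colorGens (K := K) _ a t Finset.univ c rfl
    (by simpa using h)
  obtain ⟨P, hP⟩ := exists_eval_ne_zero hG
  have h1 := hG' P hP
  refine hf.spansForms (fun μ hμ => hμ.1) id (colorProd Finset.univ c P)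
    (fun i => by rw [← hc i]; exact colorProd_isHomogeneous _ _ _ _)
    fun p hp => ?_
  have h2 := homogeneousComponent_mem_span_monomial_mul _ (colorDeg a Finset.univ c)
    (colorGens_isHomogeneous _ _ _ _) t (h1 p hp)
  rw [homogeneousComponent_eq_self hp] at h2
  refine Submodule.span_le.2 ?_ h2
  rintro _ ⟨⟨⟨- | i, w⟩, hw⟩, rfl⟩
  · refine Submodule.mem_sup_left (Submodule.subset_span ⟨w + Finsupp.single (Fin.last n) a, ?_, ?_⟩)
    · simp only [colorDeg] at hw
      simp [hw]
    · simp [colorGens, X_pow_eq_monomial, monomial_mul]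
  · exact Submodule.mem_sup_right (Ideal.mul_mem_left _ _ (Ideal.subset_span ⟨i, rfl⟩))

section order

variable {n : ℕ} {a b c : Fin n →₀ ℕ}

theorem DrlLT.irrefl (a : Fin n →₀ ℕ) : ¬ DrlLT a a := by
  rintro (h | ⟨-, i, h, -⟩) <;> exact lt_irrefl _ h

theorem DrlLT.trans (hab : DrlLT a b) (hbc : DrlLT b c) : DrlLT a c := by
  rcases hab with hab | ⟨hab, i, hi, hi'⟩
  · rcases hbc with hbc | ⟨hbc, -⟩
    · exact Or.inl (hab.trans hbc)
    · exact Or.inl (hbc ▸ hab)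
  · rcases hbc with hbc | ⟨hbc, j, hj, hj'⟩
    · exact Or.inl (hab ▸ hbc)
    · refine Or.inr ⟨hab.trans hbc, ?_⟩
      rcases lt_trichotomy i j with h | rfl | h
      · exact ⟨j, hi' j h ▸ hj, fun k hk => (hi' k (h.trans hk)).trans (hj' k hk)⟩
      · exact ⟨i, hj.trans hi, fun k hk => (hi' k hk).trans (hj' k hk)⟩
      · exact ⟨i, hj' i h ▸ hi, fun k hk => (hi' k hk).trans (hj' k (h.trans hk))⟩

theorem DrlLT.total (a b : Fin n →₀ ℕ) : DrlLT a b ∨ a = b ∨ DrlLT b a := by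
  rcases lt_trichotomy (expDeg a) (expDeg b) with h | h | h
  · exact Or.inl (Or.inl h)
  · by_cases hab : a = b
    · exact Or.inr (Or.inl hab)
    · have hne : (Finset.univ.filter fun i => a i ≠ b i).Nonempty := by
        by_contra hemp
        rw [Finset.not_nonempty_iff_eq_empty, Finset.filter_eq_empty_iff] at hemp
        exact hab (Finsupp.ext fun i => not_not.1 (hemp (Finset.mem_univ i)))
      have hm := Finset.max'_mem _ hne
      have hlt : ∀ j, Finset.max' _ hne < j → a j = b j := fun j hj => by
        by_contra hj'
        exact absurd (Finset.le_max' _ j (Finset.mem_filter.2 ⟨Finset.mem_univ j, hj'⟩))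
          (not_le.2 hj)
      rw [Finset.mem_filter] at hm
      rcases lt_or_gt_of_ne hm.2 with h' | h'
      · exact Or.inr (Or.inr (Or.inr ⟨h.symm, _, h', fun j hj => (hlt j hj).symm⟩))
      · exact Or.inl (Or.inr ⟨h, _, h', hlt⟩)
  · exact Or.inr (Or.inr (Or.inl h))

theorem expDeg_add (a b : Fin n →₀ ℕ) : expDeg (a + b) = expDeg a + expDeg b := by
  simp [expDeg_eq_sum, Finset.sum_add_distrib]

theorem DrlLT.add_left (h : DrlLT a b) (c : Fin n →₀ ℕ) : DrlLT (c + a) (c + b) := by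
  rcases h with h | ⟨h, i, hi, hi'⟩
  · exact Or.inl (by rw [expDeg_add, expDeg_add]; omega)
  · refine Or.inr ⟨by rw [expDeg_add, expDeg_add, h], i, ?_, fun j hj => ?_⟩
    · simpa using hi
    · simpa using hi' j hj

theorem drlLT_embExp {a b : Fin n →₀ ℕ} : DrlLT (embExp a) (embExp b) ↔ DrlLT a b := by
  unfold DrlLT
  simp only [expDeg_embExp]
  refine or_congr Iff.rfl (and_congr_right fun _ => ⟨?_, ?_⟩)
  · rintro ⟨i, hi, hi'⟩
    induction i using Fin.lastCases with
    | last => simp at hi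
    | cast i =>
      exact ⟨i, by simpa using hi, fun j hj => by
        simpa using hi' j.castSucc (Fin.castSucc_lt_castSucc_iff.2 hj)⟩
  · rintro ⟨i, hi, hi'⟩
    refine ⟨i.castSucc, by simpa using hi, fun j hj => ?_⟩
    induction j using Fin.lastCases with
    | last => simp
    | cast j => simpa using hi' j (Fin.castSucc_lt_castSucc_iff.1 hj)

theorem drlLT_of_last {a b : Fin (n + 1) →₀ ℕ} (h : expDeg a = expDeg b)
    (hlt : b (Fin.last n) < a (Fin.last n)) : DrlLT a b :=
  Or.inr ⟨h, Fin.last n, hlt, fun j hj => absurd (Fin.le_last j) (not_le.2 hj)⟩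

theorem exists_drl_max {s : Set (Fin n →₀ ℕ)} (hs : s.Finite) (hne : s.Nonempty) :
    ∃ μ ∈ s, ∀ ν ∈ s, ν ≠ μ → DrlLT ν μ := by
  induction s, hs using Set.Finite.induction_on with
  | empty => exact absurd hne Set.not_nonempty_empty
  | @insert a s _ _ ih =>
    rcases s.eq_empty_or_nonempty with rfl | h
    · exact ⟨a, by simp, by simp⟩
    · obtain ⟨μ, hμ, hmax⟩ := ih h
      by_cases haμ : DrlLT μ a
      · refine ⟨a, Set.mem_insert _ _, ?_⟩
        rintro ν (rfl | hν) hne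
        · exact absurd rfl hne
        · by_cases hνμ : ν = μ
          · exact hνμ ▸ haμ
          · exact (hmax ν hν hνμ).trans haμ
      · refine ⟨μ, Set.mem_insert_of_mem _ hμ, ?_⟩
        rintro ν (rfl | hν) hne
        · rcases DrlLT.total ν μ with h | h | h
          · exact h
          · exact absurd h hne
          · exact absurd h haμ
        · exact hmax ν hν hne

theorem exists_drl_min {s : Set (Fin n →₀ ℕ)} (hs : s.Finite) (hne : s.Nonempty) :
    ∃ μ ∈ s, ∀ ν, DrlLT ν μ → ν ∉ s := by
  induction s, hs using Set.Finite.induction_on with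
  | empty => exact absurd hne Set.not_nonempty_empty
  | @insert a s _ _ ih =>
    rcases s.eq_empty_or_nonempty with rfl | h
    · refine ⟨a, by simp, fun ν hν hν' => ?_⟩
      rcases hν' with rfl | hν'
      · exact DrlLT.irrefl _ hν
      · exact hν'
    · obtain ⟨μ, hμ, hmin⟩ := ih h
      by_cases haμ : DrlLT a μ
      · refine ⟨a, Set.mem_insert _ _, ?_⟩
        rintro ν hν (rfl | hν')
        · exact DrlLT.irrefl _ hν
        · exact hmin ν (hν.trans haμ) hν'
      · refine ⟨μ, Set.mem_insert_of_mem _ hμ, ?_⟩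
        rintro ν hν (rfl | hν')
        · exact haμ hν
        · exact hmin ν hν hν'

end order

section initial

variable {n : ℕ} {K : Type*} [Field K]

theorem exists_isLeadExp {p : MvPolynomial (Fin n) K} (hp : p ≠ 0) : ∃ μ, IsLeadExp p μ := by
  obtain ⟨μ, hμ, h⟩ := exists_drl_max p.support.finite_toSet
    (by simpa [Set.nonempty_iff_ne_empty] using hp)
  exact ⟨μ, hμ, h⟩

/-- Homogeneous ideals, in terms of homogeneous components. -/
def IsHomogIdeal {σ K : Type*} [CommRing K] (I : Ideal (MvPolynomial σ K)) : Prop :=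
  ∀ p ∈ I, ∀ t, homogeneousComponent t p ∈ I

theorem isHomogIdeal_span {σ ι K : Type*} [CommRing K] (φ : ι → MvPolynomial σ K) (e : ι → ℕ)
    (hφ : ∀ i, (φ i).IsHomogeneous (e i)) : IsHomogIdeal (Ideal.span (Set.range φ)) := by
  intro p hp t
  refine (Submodule.span_le (p := (Ideal.span (Set.range φ)).restrictScalars K)).2 ?_
    (homogeneousComponent_mem_span_monomial_mul φ e hφ t hp)
  rintro _ ⟨⟨⟨i, w⟩, hw⟩, rfl⟩
  exact Ideal.mul_mem_left _ _ (Ideal.subset_span ⟨i, rfl⟩)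

theorem monomial_mem_initialIdeal_iff {I : Ideal (MvPolynomial (Fin n) K)} {μ : Fin n →₀ ℕ} :
    monomial μ (1 : K) ∈ initialIdeal I ↔ ∃ p ∈ I, IsLeadExp p μ := by
  constructor
  · intro h
    have hset : { m | ∃ p ∈ I, p ≠ 0 ∧ ∃ μ, IsLeadExp p μ ∧ m = monomial μ (1 : K) } =
        (fun ν => monomial ν (1 : K)) '' { ν | ∃ p ∈ I, IsLeadExp p ν } := by
      ext m
      constructor
      · rintro ⟨p, hp, -, ν, hν, rfl⟩
        exact ⟨ν, ⟨p, hp, hν⟩, rfl⟩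
      · rintro ⟨ν, ⟨p, hp, hν⟩, rfl⟩
        refine ⟨p, hp, ?_, ν, hν, rfl⟩
        rintro rfl
        simpa using hν.1
    rw [initialIdeal, hset, mem_ideal_span_monomial_image] at h
    obtain ⟨ν, ⟨p, hp, hν⟩, hle⟩ := h μ (by simp)
    obtain ⟨w, rfl⟩ := exists_add_of_le hle
    refine ⟨monomial w 1 * p, I.mul_mem_left _ hp, ?_, fun ξ hξ hne => ?_⟩
    · rw [mem_support_iff, add_comm, coeff_monomial_mul, one_mul]
      exact mem_support_iff.1 hν.1
    · rw [mem_support_iff, coeff_monomial_mul'] at hξ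
      split_ifs at hξ with hw
      · obtain ⟨ξ, rfl⟩ := exists_add_of_le hw
        rw [add_tsub_cancel_left, one_mul] at hξ
        rw [add_comm ν w]
        refine (hν.2 ξ (mem_support_iff.2 hξ) ?_).add_left w
        rintro rfl
        exact hne (add_comm _ _)
      · exact absurd rfl hξ
  · rintro ⟨p, hp, hμ⟩
    refine Ideal.subset_span ⟨p, hp, ?_, μ, hμ, rfl⟩
    rintro rfl
    simpa using hμ.1

theorem IsLeadExp.homogeneousComponent {p : MvPolynomial (Fin n) K} {μ : Fin n →₀ ℕ}
    (h : IsLeadExp p μ) : IsLeadExp (homogeneousComponent (expDeg μ) p) μ := by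
  refine ⟨?_, fun ν hν hne => h.2 ν ?_ hne⟩
  · rw [mem_support_iff, coeff_homogeneousComponent, ← expDeg_eq_degree, if_pos rfl]
    exact mem_support_iff.1 h.1
  · rw [mem_support_iff, coeff_homogeneousComponent] at hν
    split_ifs at hν with h'
    · exact mem_support_iff.2 hν
    · exact absurd rfl hν

theorem IsHomogIdeal.exists_isLeadExp {I : Ideal (MvPolynomial (Fin n) K)} (hI : IsHomogIdeal I)
    {μ : Fin n →₀ ℕ} (h : monomial μ (1 : K) ∈ initialIdeal I) :
    ∃ p ∈ I, p.IsHomogeneous (expDeg μ) ∧ IsLeadExp p μ := by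
  obtain ⟨p, hp, hμ⟩ := monomial_mem_initialIdeal_iff.1 h
  exact ⟨_, hI p hp _, homogeneousComponent_isHomogeneous _ _, hμ.homogeneousComponent⟩

theorem monomial_mem_initialIdeal_of_le {I : Ideal (MvPolynomial (Fin n) K)} {μ ν : Fin n →₀ ℕ}
    (h : monomial μ (1 : K) ∈ initialIdeal I) (hle : μ ≤ ν) :
    monomial ν (1 : K) ∈ initialIdeal I := by
  obtain ⟨w, rfl⟩ := exists_add_of_le hle
  have : monomial (μ + w) (1 : K) = monomial w 1 * monomial μ 1 := by
    rw [monomial_mul, one_mul, add_comm]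
  rw [this]
  exact Ideal.mul_mem_left _ _ h

theorem finite_expDeg_eq (n t : ℕ) : { μ : Fin n →₀ ℕ | expDeg μ = t }.Finite :=
  finite_degree_eq (σ := Fin n) t

theorem stdMon_finite (I : Ideal (MvPolynomial (Fin n) K)) (t : ℕ) : (stdMon I t).Finite :=
  (finite_expDeg_eq n t).subset fun _ h => h.1

/-- Macaulay: the standard monomials span modulo the ideal. -/
theorem IsHomogIdeal.spansForms_stdMon {I : Ideal (MvPolynomial (Fin n) K)} (hI : IsHomogIdeal I)
    (t : ℕ) : SpansForms (stdMon I t) I t := by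
  refine SpansForms.of_monomial fun μ hμ => ?_
  set V := Submodule.span K ((fun μ => monomial μ (1 : K)) '' stdMon I t) ⊔ I.restrictScalars K
  by_contra hV
  obtain ⟨μ, ⟨hμt, hμV⟩, hmin⟩ := exists_drl_min
    (s := { μ | expDeg μ = t ∧ monomial μ (1 : K) ∉ V })
    ((finite_expDeg_eq n t).subset fun _ h => h.1) ⟨μ, hμ, hV⟩
  have hin : monomial μ (1 : K) ∈ initialIdeal I := by
    by_contra hin
    exact hμV (Submodule.mem_sup_left (Submodule.subset_span ⟨μ, ⟨hμt, hin⟩, rfl⟩))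
  obtain ⟨p, hp, hhom, hlead⟩ := hI.exists_isLeadExp hin
  have hc : p.coeff μ ≠ 0 := mem_support_iff.1 hlead.1
  refine hμV ?_
  have h1 : p - monomial μ (p.coeff μ) ∈ V := by
    have : p - monomial μ (p.coeff μ) = ∑ ν ∈ p.support.erase μ, monomial ν (p.coeff ν) := by
      rw [sub_eq_iff_eq_add, Finset.sum_erase_add _ _ hlead.1, ← p.as_sum]
    rw [this]
    refine Submodule.sum_mem _ fun ν hν => ?_
    rw [Finset.mem_erase] at hν
    have h2 := hmin ν (hlead.2 ν hν.2 hν.1)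
    have h3 : expDeg ν = t := by
      by_contra hne
      exact mem_support_iff.1 hν.2 (hhom.coeff_eq_zero (hμt ▸ hne))
    have h4 : monomial ν (1 : K) ∈ V := by
      by_contra h4
      exact h2 ⟨h3, h4⟩
    have := V.smul_mem (p.coeff ν) h4
    rwa [smul_monomial, smul_eq_mul, mul_one] at this
  have h5 : monomial μ (p.coeff μ) ∈ V := by
    have := V.sub_mem (Submodule.mem_sup_right hp) h1
    rwa [sub_sub_cancel] at this
  have := V.smul_mem (p.coeff μ)⁻¹ h5
  rwa [smul_monomial, smul_eq_mul, inv_mul_cancel₀ hc] at this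

theorem support_subset_of_mem_span {σ : Type*} {W : Set (σ →₀ ℕ)} {p : MvPolynomial σ K}
    (h : p ∈ Submodule.span K ((fun μ => monomial μ (1 : K)) '' W)) : ↑p.support ⊆ W := by
  classical
  induction h using Submodule.span_induction with
  | mem x hx =>
    obtain ⟨μ, hμ, rfl⟩ := hx
    intro ν hν
    rw [Finset.mem_coe, mem_support_iff, coeff_monomial] at hν
    split_ifs at hν with h
    · exact h ▸ hμ
    · exact absurd rfl hν
  | zero => simp
  | add x y _ _ hx hy =>
    intro ν hν
    rcases Finset.mem_union.1 (support_add hν) with h | h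
    · exact hx h
    · exact hy h
  | smul a x _ hx => exact fun ν hν => hx (support_smul hν)

theorem eq_zero_of_mem_span_stdMon {I : Ideal (MvPolynomial (Fin n) K)} {t : ℕ}
    {p : MvPolynomial (Fin n) K} (hp : p ∈ I)
    (h : p ∈ Submodule.span K ((fun μ => monomial μ (1 : K)) '' stdMon I t)) : p = 0 := by
  by_contra hne
  obtain ⟨μ, hμ⟩ := exists_isLeadExp hne
  exact (support_subset_of_mem_span h hμ.1).2 (monomial_mem_initialIdeal_iff.2 ⟨p, hp, hμ⟩)

end initial

theorem ncard_le_of_image_subset_span {K M ι : Type*} [Field K] [AddCommGroup M] [Module K M]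
    {A : Set ι} {v : ι → M} (hA : LinearIndependent K fun a : A => v a) {w : Set M}
    (hw : w.Finite) (h : ∀ a ∈ A, v a ∈ Submodule.span K w) : A.ncard ≤ w.ncard := by
  have := hw.fintype
  have hr : Set.range (fun a : A => v a) ≤ Submodule.span K w := by
    rintro _ ⟨a, rfl⟩
    exact h a a.2
  have := hA.finite_of_le_span_finite _ w hr
  have := Fintype.ofFinite A
  rw [Set.ncard_eq_toFinset_card', Set.ncard_eq_toFinset_card', Set.toFinset_card,
    Set.toFinset_card]
  exact linearIndependent_le_span_aux' _ hA w hr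

theorem linearIndependent_monomial {σ K : Type*} [Field K] (A : Set (σ →₀ ℕ)) :
    LinearIndependent K fun μ : A => (monomial μ.1 1 : MvPolynomial σ K) := by
  have := (basisMonomials σ K).linearIndependent
  rw [coe_basisMonomials] at this
  exact this.comp _ Subtype.val_injective

theorem boxSet_finite {n : ℕ} (d : Fin n → ℕ) (r t : ℕ) : (boxSet d r t).Finite :=
  (finite_expDeg_eq n t).subset fun _ h => h.1

theorem ncard_stdMon_le {n : ℕ} {K : Type*} [Field K] {I : Ideal (MvPolynomial (Fin n) K)}
    {W : Set (Fin n →₀ ℕ)} {t : ℕ} (hW : W.Finite) (h : SpansForms W I t) :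
    (stdMon I t).ncard ≤ W.ncard := by
  set q := (I.restrictScalars K).mkQ with hq
  have hli : LinearIndependent K fun μ : stdMon I t => q (monomial μ.1 1) := by
    refine (linearIndependent_monomial (K := K) (stdMon I t)).map (f := q) ?_
    rw [Submodule.disjoint_def]
    intro p hp hp'
    rw [hq, Submodule.ker_mkQ] at hp'
    refine eq_zero_of_mem_span_stdMon (t := t) hp' ?_
    rwa [Set.image_eq_range]
  refine (ncard_le_of_image_subset_span (v := fun μ => q (monomial μ 1)) hli
    (hW.image fun μ => q (monomial μ 1)) fun μ hμ => ?_).trans (Set.ncard_image_le hW)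
  have h1 := h ((mem_homogeneousSubmodule _ _).2 (isHomogeneous_monomial (1 : K) hμ.1))
  obtain ⟨s, hs, j, hj, hsj⟩ := Submodule.mem_sup.1 h1
  have hqj : q j = 0 := (Submodule.Quotient.mk_eq_zero _).2 hj
  rw [← hsj, map_add, hqj, add_zero]
  have := Submodule.mem_map_of_mem (f := q) hs
  rwa [Submodule.map_span, Set.image_image] at this

theorem mem_homogeneousSubmodule_of_mem_span {σ K : Type*} [CommRing K] {W : Set (σ →₀ ℕ)} {t : ℕ}
    (hW : ∀ μ ∈ W, μ.degree = t) {p : MvPolynomial σ K}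
    (h : p ∈ Submodule.span K ((fun μ => monomial μ (1 : K)) '' W)) : p.IsHomogeneous t := by
  rw [← mem_homogeneousSubmodule]
  refine Submodule.span_le.2 ?_ h
  rintro _ ⟨μ, hμ, rfl⟩
  exact isHomogeneous_monomial _ (hW μ hμ)

/-- The degree `t` part of the ideal generated by the first `r` forms of a generic sequence is
spanned by at most as many elements as there are monomials of degree `t` outside
`boxSet d r t`. -/
theorem IsGenericSeq.exists_span_of_lt {F K : Type*} [Field F] [Field K] [Algebra F K] {n : ℕ}
    {d : Fin n → ℕ} {f : Fin n → MvPolynomial (Fin n) K} (hf : IsGenericSeq F d f) (t : ℕ) :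
    ∀ r ≤ n, ∃ w : Set (MvPolynomial (Fin n) K), w.Finite ∧
      (∀ p ∈ Ideal.span (Set.range (f ∘ (Subtype.val : { i : Fin n // i.val < r } → Fin n))),
        p.IsHomogeneous t → p ∈ Submodule.span K w) ∧
      w.ncard + (boxSet d r t).ncard ≤ (boxSet d 0 t).ncard := by
  intro r
  induction r with
  | zero =>
    refine fun _ => ⟨∅, Set.finite_empty, fun p hp _ => ?_, by simp⟩
    have : IsEmpty { i : Fin n // i.val < 0 } := ⟨fun i => absurd i.2 (Nat.not_lt_zero _)⟩
    rw [Set.range_eq_empty, Ideal.span_empty, Ideal.mem_bot] at hp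
    rw [hp]; exact zero_mem _
  | succ r ih =>
    intro hr
    obtain ⟨w, hw, hspan, hcard⟩ := ih (by omega)
    let k : Fin n := ⟨r, hr⟩
    let A : Set (Fin n →₀ ℕ) := { γ | γ.degree + d k = t ∧ ∀ i : Fin n, i.val < r → γ i < d i }
    have hA : A.Finite := (finite_expDeg_eq n (t - d k)).subset fun γ hγ => by
      have := hγ.1
      show γ.degree = _
      omega
    refine ⟨w ∪ (fun γ => monomial γ 1 * f k) '' A, hw.union (hA.image _), fun p hp hpt => ?_, ?_⟩
    · have h1 := homogeneousComponent_mem_span_monomial_mul _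
        (fun i : { i : Fin n // i.val < r + 1 } => d i) (fun i => hf.1 i.1) t hp
      rw [homogeneousComponent_eq_self hpt] at h1
      refine Submodule.span_le.2 ?_ h1
      rintro _ ⟨⟨⟨⟨i, hi⟩, γ⟩, hγ⟩, rfl⟩
      simp only at hγ
      have hmul : ∀ q : MvPolynomial (Fin n) K, q ∈ Ideal.span (Set.range
          (f ∘ (Subtype.val : { i : Fin n // i.val < r } → Fin n))) → q.IsHomogeneous t →
          q ∈ Submodule.span K (w ∪ (fun γ => monomial γ 1 * f k) '' A) := fun q hq hqt =>
        Submodule.span_mono Set.subset_union_left (hspan q hq hqt)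
      rcases Nat.lt_succ_iff_lt_or_eq.1 hi with hi' | hi'
      · refine hmul _ (Ideal.mul_mem_left _ _ (Ideal.subset_span ⟨⟨i, hi'⟩, rfl⟩)) ?_
        show (monomial γ 1 * f i).IsHomogeneous t
        rw [← hγ]
        exact (isHomogeneous_monomial _ rfl).mul (hf.1 i)
      · obtain rfl : i = k := Fin.ext hi'
        obtain ⟨s, hs, j, hj, hsj⟩ := Submodule.mem_sup.1 (hf.spansForms_boxSet r γ.degree
          ((mem_homogeneousSubmodule _ _).2 (isHomogeneous_monomial (1 : K) rfl)))
        have hs' := mem_homogeneousSubmodule_of_mem_span (fun μ hμ => hμ.1) hs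
        have hj' : j.IsHomogeneous γ.degree := by
          rw [← sub_eq_iff_eq_add'.2 hsj.symm]
          exact (isHomogeneous_monomial _ rfl).sub hs'
        show monomial γ 1 * f k ∈ Submodule.span K _
        rw [← hsj, add_mul]
        refine add_mem (Submodule.span_mono Set.subset_union_right ?_) (hmul _ ?_ ?_)
        · have := Submodule.mem_map_of_mem (f := LinearMap.mulRight K (f k)) hs
          rw [Submodule.map_span, Set.image_image] at this
          refine Submodule.span_mono ?_ this
          rintro _ ⟨μ, hμ, rfl⟩
          exact ⟨μ, ⟨by rw [hμ.1]; exact hγ, hμ.2⟩, rfl⟩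
        · rw [mul_comm]
          exact Ideal.mul_mem_left _ _ hj
        · rw [← hγ]
          exact hj'.mul (hf.1 k)
    · have h1 : A.ncard + (boxSet d (r + 1) t).ncard ≤ (boxSet d r t).ncard := by
        have hinj : Function.Injective fun γ : Fin n →₀ ℕ => γ + Finsupp.single k (d k) :=
          add_left_injective _
        rw [← Set.ncard_image_of_injective A hinj, ← Set.ncard_union_eq _ (hA.image _)
          (boxSet_finite _ _ _)]
        · refine Set.ncard_le_ncard ?_ (boxSet_finite _ _ _)
          rintro μ (⟨γ, hγ, rfl⟩ | hμ)
          · refine ⟨by simpa using hγ.1, fun i hi => ?_⟩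
            have : k ≠ i := by
              rintro rfl
              exact lt_irrefl _ hi
            simpa [Finsupp.single_apply, this] using hγ.2 i hi
          · exact ⟨hμ.1, fun i hi => hμ.2 i (by omega)⟩
        · rw [Set.disjoint_left]
          rintro _ ⟨γ, hγ, rfl⟩ h
          have := h.2 k (Nat.lt_succ_self r)
          simp at this
      have h2 := Set.ncard_union_le w ((fun γ => monomial γ 1 * f k) '' A)
      have h3 := Set.ncard_image_le (f := fun γ => (monomial γ 1 * f k : MvPolynomial (Fin n) K)) hA
      omega

/-- The Hilbert function of a generic complete intersection. -/
theorem IsGenericSeq.ncard_stdMon {F K : Type*} [Field F] [Field K] [Algebra F K] {n : ℕ}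
    {d : Fin n → ℕ} {f : Fin n → MvPolynomial (Fin n) K} (hf : IsGenericSeq F d f) (t : ℕ) :
    (stdMon (Ideal.span (Set.range f)) t).ncard = (boxSet d n t).ncard := by
  have hrange : Set.range (f ∘ (Subtype.val : { i : Fin n // i.val < n } → Fin n)) =
      Set.range f := by
    ext p
    exact ⟨fun ⟨i, hi⟩ => ⟨i.1, hi⟩, fun ⟨i, hi⟩ => ⟨⟨i, i.2⟩, hi⟩⟩
  have hhom : IsHomogIdeal (Ideal.span (Set.range f)) := isHomogIdeal_span f d hf.1
  refine le_antisymm ?_ ?_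
  · have := hf.spansForms_boxSet n t
    rw [hrange] at this
    exact ncard_stdMon_le (boxSet_finite _ _ _) this
  · obtain ⟨w, hw, hspan, hcard⟩ := hf.exists_span_of_lt t n le_rfl
    rw [hrange] at hspan
    have hstd := stdMon_finite (Ideal.span (Set.range f)) t
    have h1 := ncard_le_of_image_subset_span (K := K) (linearIndependent_monomial (boxSet d 0 t))
      ((hstd.image fun μ => (monomial μ (1 : K))).union hw) (v := fun μ => monomial μ (1 : K))
      fun μ hμ => by
        have hμ' := isHomogeneous_monomial (1 : K) hμ.1
        obtain ⟨s, hs, j, hj, hsj⟩ := Submodule.mem_sup.1 (hhom.spansForms_stdMon t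
          ((mem_homogeneousSubmodule _ _).2 hμ'))
        have hs' := mem_homogeneousSubmodule_of_mem_span (fun μ hμ => hμ.1) hs
        have hj' : j.IsHomogeneous t := by
          rw [← sub_eq_iff_eq_add'.2 hsj.symm]
          exact hμ'.sub hs'
        rw [← hsj]
        exact add_mem (Submodule.span_mono Set.subset_union_left hs)
          (Submodule.span_mono Set.subset_union_right (hspan j hj hj'))
    have h2 := Set.ncard_union_le ((fun μ => (monomial μ (1 : K))) ''
      stdMon (Ideal.span (Set.range f)) t) w
    have h3 := Set.ncard_image_le (f := fun μ => (monomial μ (1 : K))) hstd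
    omega

section zShift

variable {n : ℕ}

@[simp] theorem zShift_last (c : ℕ) (μ : Fin (n + 1) →₀ ℕ) :
    zShift c μ (Fin.last n) = μ (Fin.last n) + c := by
  simp [zShift]

@[simp] theorem zShift_castSucc (c : ℕ) (μ : Fin (n + 1) →₀ ℕ) (i : Fin n) :
    zShift c μ i.castSucc = μ i.castSucc := by
  simp [zShift]

theorem zShift_injective (c : ℕ) : Function.Injective (zShift (n := n) c) :=
  add_left_injective _

@[simp] theorem expDeg_zShift (c : ℕ) (μ : Fin (n + 1) →₀ ℕ) :
    expDeg (zShift c μ) = expDeg μ + c := by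
  simp [zShift, expDeg_eq_degree]

theorem le_zShift (c : ℕ) (μ : Fin (n + 1) →₀ ℕ) : μ ≤ zShift c μ :=
  le_add_of_nonneg_right (zero_le)

theorem zShift_mono {a b : ℕ} (h : a ≤ b) (μ : Fin (n + 1) →₀ ℕ) : zShift a μ ≤ zShift b μ :=
  add_le_add_right (Finsupp.single_mono h) _

theorem exists_zShift_eq {c : ℕ} {μ : Fin (n + 1) →₀ ℕ} (h : c ≤ μ (Fin.last n)) :
    ∃ ν, zShift c ν = μ :=
  ⟨μ - Finsupp.single (Fin.last n) c, tsub_add_cancel_of_le (Finsupp.single_le_iff.2 h)⟩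

end zShift

section boxCount

variable {n : ℕ}

theorem ncard_boxSet_le_of_add_eq {d : Fin n → ℕ} {t t' : ℕ} (h : t + t' + n = ∑ i, d i) :
    (boxSet d n t).ncard ≤ (boxSet d n t').ncard := by
  refine Set.ncard_le_ncard_of_injOn
    (fun μ => Finsupp.equivFunOnFinite.symm fun i => d i - 1 - μ i) ?_ ?_ (boxSet_finite _ _ _)
  · rintro μ ⟨hμ, hμd⟩
    refine ⟨?_, fun i hi => ?_⟩
    · have h1 : ∑ i, (d i - 1 - μ i) + ∑ i, μ i + ∑ _i : Fin n, 1 = ∑ i, d i := by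
        rw [← Finset.sum_add_distrib, ← Finset.sum_add_distrib]
        refine Finset.sum_congr rfl fun i _ => ?_
        have := hμd i i.2
        omega
      rw [← expDeg_eq_degree, expDeg_eq_sum] at hμ ⊢
      simp only [Finset.sum_const, Finset.card_univ, Fintype.card_fin, smul_eq_mul, mul_one] at h1
      simp only [Finsupp.equivFunOnFinite_symm_apply_apply]
      omega
    · have := hμd i i.2
      simp only [Finsupp.equivFunOnFinite_symm_apply_apply]
      omega
  · rintro μ ⟨_, hμ⟩ ν ⟨_, hν⟩ h
    ext i
    have h1 := DFunLike.congr_fun h i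
    simp only [Finsupp.equivFunOnFinite_symm_apply_apply] at h1
    have := hμ i i.2
    have := hν i i.2
    omega

theorem mem_boxSet_snoc {d : Fin n → ℕ} {D t : ℕ} {μ : Fin (n + 1) →₀ ℕ} :
    μ ∈ boxSet (Fin.snoc d D : Fin (n + 1) → ℕ) (n + 1) t ↔
      expDeg μ = t ∧ (∀ i : Fin n, μ i.castSucc < d i) ∧ μ (Fin.last n) < D := by
  refine and_congr Iff.rfl ⟨fun h => ⟨fun i => ?_, ?_⟩, fun h i _ => ?_⟩
  · simpa using h i.castSucc (by simp)
  · simpa using h (Fin.last n) (by simp)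
  · induction i using Fin.lastCases with
    | last => simpa using h.2
    | cast i => simpa using h.1 i

theorem mem_boxSet_self {d : Fin n → ℕ} {t : ℕ} {μ : Fin n →₀ ℕ} :
    μ ∈ boxSet d n t ↔ expDeg μ = t ∧ ∀ i, μ i < d i :=
  and_congr Iff.rfl ⟨fun h i => h i i.2, fun h i _ => h i⟩

theorem ncard_boxSet_snoc {d : Fin n → ℕ} {D t : ℕ} (hD : 1 ≤ D) (ht : D ≤ t) :
    (boxSet (Fin.snoc d D : Fin (n + 1) → ℕ) (n + 1) t).ncard + (boxSet d n (t - D)).ncard =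
      (boxSet (Fin.snoc d D : Fin (n + 1) → ℕ) (n + 1) (t - 1)).ncard + (boxSet d n t).ncard := by
  have hD' := (zShift_injective (n := n) D).comp embExp_injective
  rw [← Set.ncard_image_of_injective (boxSet d n (t - D)) hD',
    ← Set.ncard_image_of_injective (boxSet d n t) embExp_injective,
    ← Set.ncard_image_of_injective (boxSet (Fin.snoc d D : Fin (n + 1) → ℕ) (n + 1) (t - 1))
      (zShift_injective 1),
    ← Set.ncard_union_eq _ (boxSet_finite _ _ _) ((boxSet_finite _ _ _).image _),
    ← Set.ncard_union_eq _ ((boxSet_finite _ _ _).image _) ((boxSet_finite _ _ _).image _)]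
  · congr 1
    ext μ
    simp only [Set.mem_union, Set.mem_image, mem_boxSet_snoc, Function.comp_apply]
    simp only [mem_boxSet_self]
    constructor
    · rintro (⟨h1, h2, h3⟩ | ⟨ν, ⟨h1, h2⟩, rfl⟩)
      · by_cases h : μ (Fin.last n) = 0
        · obtain ⟨ν, rfl⟩ := exists_embExp_eq h
          exact Or.inr ⟨ν, ⟨by simpa using h1, by simpa using h2⟩, rfl⟩
        · obtain ⟨ν, rfl⟩ := exists_zShift_eq (Nat.one_le_iff_ne_zero.2 h)
          simp only [zShift_last, zShift_castSucc, expDeg_zShift] at h1 h2 h3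
          exact Or.inl ⟨ν, ⟨by omega, h2, by omega⟩, rfl⟩
      · refine Or.inl ⟨zShift (D - 1) (embExp ν), ⟨?_, ?_, ?_⟩, ?_⟩
        · simp; omega
        · simpa using h2
        · simp; omega
        · rw [zShift, zShift, add_assoc, ← Finsupp.single_add, Nat.sub_add_cancel hD]; rfl
    · rintro (⟨ν, ⟨h1, h2, h3⟩, rfl⟩ | ⟨ν, ⟨h1, h2⟩, rfl⟩)
      · by_cases h : ν (Fin.last n) + 1 < D
        · exact Or.inl ⟨by simp; omega, by simpa using h2, by simpa using h⟩
        · obtain ⟨ξ, hξ⟩ := exists_zShift_eq (c := D) (μ := zShift 1 ν) (by simp; omega)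
          have h4 := DFunLike.congr_fun hξ (Fin.last n)
          simp only [zShift_last] at h4
          obtain ⟨ξ, rfl⟩ := exists_embExp_eq (μ := ξ) (by omega)
          have h5 := congrArg expDeg hξ
          simp only [expDeg_zShift, expDeg_embExp] at h5
          refine Or.inr ⟨ξ, ⟨by omega, fun i => ?_⟩, hξ⟩
          have h6 := DFunLike.congr_fun hξ i.castSucc
          simp only [zShift_castSucc, embExp_castSucc] at h6
          exact h6 ▸ h2 i
      · exact Or.inl ⟨by simpa using h1, by simpa using h2, by simp; omega⟩
  · rw [Set.disjoint_left]
    rintro _ ⟨ν, _, rfl⟩ ⟨ξ, _, h⟩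
    have := DFunLike.congr_fun h (Fin.last n)
    simp at this
  · rw [Set.disjoint_left]
    rintro μ hμ ⟨ξ, _, rfl⟩
    have := (mem_boxSet_snoc.1 hμ).2.2
    simp at this

end boxCount

section standardMonomials

variable {F K : Type*} [Field F] [Field K] [Algebra F K] {n : ℕ}

theorem notMem_initialIdeal_of_le {I : Ideal (MvPolynomial (Fin n) K)} {μ ν : Fin n →₀ ℕ}
    (h : monomial ν (1 : K) ∉ initialIdeal I) (hle : μ ≤ ν) :
    monomial μ (1 : K) ∉ initialIdeal I :=
  fun h' => h (monomial_mem_initialIdeal_of_le h' hle)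

theorem isLeadExp_monomial_sub {μ : Fin n →₀ ℕ} {s : MvPolynomial (Fin n) K}
    (h : ∀ ν ∈ s.support, DrlLT ν μ) : IsLeadExp (monomial μ (1 : K) - s) μ := by
  classical
  have hs : s.coeff μ = 0 := by
    by_contra h'
    exact DrlLT.irrefl μ (h μ (mem_support_iff.2 h'))
  refine ⟨by simp [hs], fun ν hν hne => h ν ?_⟩
  rw [mem_support_iff, coeff_sub, coeff_monomial, if_neg (Ne.symm hne), zero_sub, neg_ne_zero] at hν
  exact mem_support_iff.2 hν

theorem SpansForms.mem_initialIdeal {I : Ideal (MvPolynomial (Fin n) K)} {W : Set (Fin n →₀ ℕ)}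
    {t : ℕ} (h : SpansForms W I t) {μ : Fin n →₀ ℕ} (hμ : expDeg μ = t)
    (hW : ∀ ν ∈ W, DrlLT ν μ) : monomial μ (1 : K) ∈ initialIdeal I := by
  obtain ⟨s, hs, j, hj, hsj⟩ := Submodule.mem_sup.1
    (h ((mem_homogeneousSubmodule _ _).2 (isHomogeneous_monomial (1 : K) hμ)))
  refine monomial_mem_initialIdeal_iff.2 ⟨monomial μ 1 - s, ?_,
    isLeadExp_monomial_sub fun ν hν => hW ν (support_subset_of_mem_span hs hν)⟩
  rw [← hsj, add_sub_cancel_left]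
  exact hj

theorem IsGenericSeq.stdMon_eq_zShift_image [Infinite K] {d : Fin (n + 1) → ℕ}
    {f : Fin (n + 1) → MvPolynomial (Fin (n + 1)) K} (hf : IsGenericSeq F d f) {j k : ℕ}
    (hjk : j ≤ k) (h : j + k + (n + 1) = ∑ i, d i) :
    stdMon (Ideal.span (Set.range f)) k =
      zShift (k - j) '' stdMon (Ideal.span (Set.range f)) j := by
  refine Set.eq_of_subset_of_ncard_le ?_ ?_ ((stdMon_finite _ _).image _)
  · rintro μ ⟨hμ, hμI⟩
    have hle : k - j ≤ μ (Fin.last n) := by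
      by_contra hlt
      refine hμI ((hf.spansForms_last (a := k - j) (t := k) (by omega)).mem_initialIdeal hμ ?_)
      rintro ν ⟨hν, hν'⟩
      exact drlLT_of_last (hν.trans hμ.symm) (by omega)
    obtain ⟨ν, rfl⟩ := exists_zShift_eq hle
    rw [expDeg_zShift] at hμ
    exact ⟨ν, ⟨by omega, notMem_initialIdeal_of_le hμI (le_zShift _ _)⟩, rfl⟩
  · rw [Set.ncard_image_of_injective _ (zShift_injective _), hf.ncard_stdMon, hf.ncard_stdMon]
    exact ncard_boxSet_le_of_add_eq h

theorem IsGenericSeq.zShift_image_subset [Infinite K] {d : Fin (n + 1) → ℕ}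
    {f : Fin (n + 1) → MvPolynomial (Fin (n + 1)) K} (hf : IsGenericSeq F d f) {j : ℕ}
    (h : 2 * j + (n + 1) < ∑ i, d i) :
    zShift 1 '' stdMon (Ideal.span (Set.range f)) j ⊆
      stdMon (Ideal.span (Set.range f)) (j + 1) := by
  rintro _ ⟨μ, hμ, rfl⟩
  refine ⟨by rw [expDeg_zShift, hμ.1], ?_⟩
  have h1 := hf.stdMon_eq_zShift_image (j := j) (k := ∑ i, d i - (n + 1) - j) (by omega) (by omega)
  have h2 : zShift (∑ i, d i - (n + 1) - j - j) μ ∈ stdMon (Ideal.span (Set.range f)) _ :=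
    h1 ▸ Set.mem_image_of_mem _ hμ
  exact notMem_initialIdeal_of_le h2.2 (zShift_mono (by omega) _)

theorem embExp_mem_initialIdeal_iff {I : Ideal (MvPolynomial (Fin (n + 1)) K)}
    (hI : IsHomogIdeal I) {ν : Fin n →₀ ℕ} :
    monomial (embExp ν) (1 : K) ∈ initialIdeal I ↔
      monomial ν (1 : K) ∈ initialIdeal (I.map (projMap K n)) := by
  constructor
  · intro h
    obtain ⟨p, hp, hlead⟩ := monomial_mem_initialIdeal_iff.1 h
    refine monomial_mem_initialIdeal_iff.2 ⟨_, Ideal.mem_map_of_mem _ hp, ?_, fun ξ hξ hne => ?_⟩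
    · rw [mem_support_iff, coeff_projMap]
      exact mem_support_iff.1 hlead.1
    · rw [mem_support_iff, coeff_projMap] at hξ
      exact drlLT_embExp.1 (hlead.2 _ (mem_support_iff.2 hξ) (embExp_injective.ne hne))
  · intro h
    obtain ⟨q, hq, hlead⟩ := monomial_mem_initialIdeal_iff.1 h
    obtain ⟨p, hp, rfl⟩ := (Ideal.mem_map_iff_of_surjective _ projMap_surjective).1 hq
    refine monomial_mem_initialIdeal_iff.2 ⟨_, hI p hp (expDeg (embExp ν)), ?_, fun ξ hξ hne => ?_⟩
    · rw [mem_support_iff, coeff_homogeneousComponent, ← expDeg_eq_degree, if_pos rfl,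
        ← coeff_projMap]
      exact mem_support_iff.1 hlead.1
    · rw [mem_support_iff, coeff_homogeneousComponent] at hξ
      split_ifs at hξ with hdeg
      · by_cases h0 : ξ (Fin.last n) = 0
        · obtain ⟨ξ, rfl⟩ := exists_embExp_eq h0
          rw [← coeff_projMap] at hξ
          exact drlLT_embExp.2 (hlead.2 _ (mem_support_iff.2 hξ) fun h => hne (h ▸ rfl))
        · exact drlLT_of_last hdeg (by rw [embExp_last]; omega)
      · exact absurd rfl hξ

theorem IsGenericSeq.stdMon_succ [Infinite K] {d : Fin (n + 1) → ℕ}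
    {f : Fin (n + 1) → MvPolynomial (Fin (n + 1)) K} (hf : IsGenericSeq F d f) {j : ℕ}
    (h : 2 * j + (n + 1) < ∑ i, d i) :
    stdMon (Ideal.span (Set.range f)) (j + 1) =
      embExp '' stdMon ((Ideal.span (Set.range f)).map (projMap K n)) (j + 1) ∪
        zShift 1 '' stdMon (Ideal.span (Set.range f)) j := by
  have hI := isHomogIdeal_span f d hf.1
  refine Set.Subset.antisymm ?_ (Set.union_subset ?_ (hf.zShift_image_subset h))
  · rintro μ ⟨hμ, hμI⟩
    by_cases h0 : μ (Fin.last n) = 0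
    · obtain ⟨ν, rfl⟩ := exists_embExp_eq h0
      rw [expDeg_embExp] at hμ
      exact Or.inl ⟨ν, ⟨hμ, fun h => hμI ((embExp_mem_initialIdeal_iff hI).2 h)⟩, rfl⟩
    · obtain ⟨ν, rfl⟩ := exists_zShift_eq (Nat.one_le_iff_ne_zero.2 h0)
      rw [expDeg_zShift] at hμ
      exact Or.inr ⟨ν, ⟨by omega, notMem_initialIdeal_of_le hμI (le_zShift _ _)⟩, rfl⟩
  · rintro _ ⟨ν, ⟨hν, hνI⟩, rfl⟩
    exact ⟨by rw [expDeg_embExp, hν], fun h => hνI ((embExp_mem_initialIdeal_iff hI).1 h)⟩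

theorem IsGenericSeq.ncard_stdMon_succ [Infinite K] {d : Fin (n + 1) → ℕ}
    {f : Fin (n + 1) → MvPolynomial (Fin (n + 1)) K} (hf : IsGenericSeq F d f) {j : ℕ}
    (h : 2 * j + (n + 1) < ∑ i, d i) :
    (stdMon (Ideal.span (Set.range f)) (j + 1)).ncard =
      (stdMon ((Ideal.span (Set.range f)).map (projMap K n)) (j + 1)).ncard +
        (stdMon (Ideal.span (Set.range f)) j).ncard := by
  rw [hf.stdMon_succ h, Set.ncard_union_eq _ ((stdMon_finite _ _).image _)
    ((stdMon_finite _ _).image _), Set.ncard_image_of_injective _ embExp_injective,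
    Set.ncard_image_of_injective _ (zShift_injective 1)]
  rw [Set.disjoint_left]
  rintro _ ⟨ν, _, rfl⟩ ⟨ξ, _, h⟩
  have := DFunLike.congr_fun h (Fin.last n)
  simp at this

end standardMonomials

section extend

variable {K : Type*} [Field K] {n : ℕ}

theorem mem_of_isHomogeneous_of_mem_span_snoc {r t D : ℕ} {d : Fin r → ℕ}
    {f : Fin r → MvPolynomial (Fin n) K} {g : MvPolynomial (Fin n) K}
    (hf : ∀ i, (f i).IsHomogeneous (d i)) (hg : g.IsHomogeneous D) (ht : t < D)
    {p : MvPolynomial (Fin n) K} (hpt : p.IsHomogeneous t)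
    (hp : p ∈ Ideal.span (Set.range (Fin.snoc f g : Fin (r + 1) → MvPolynomial (Fin n) K))) :
    p ∈ Ideal.span (Set.range f) := by
  have h := homogeneousComponent_mem_span_monomial_mul _ (Fin.snoc d D : Fin (r + 1) → ℕ)
    (fun i => by
      induction i using Fin.lastCases with
      | last => simpa using hg
      | cast i => simpa using hf i) t hp
  rw [homogeneousComponent_eq_self hpt] at h
  refine (Submodule.span_le (p := (Ideal.span (Set.range f)).restrictScalars K)).2 ?_ h
  rintro _ ⟨⟨⟨i, w⟩, hw⟩, rfl⟩
  induction i using Fin.lastCases with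
  | last => simp at hw; omega
  | cast i =>
    simp only [Fin.snoc_castSucc]
    exact Ideal.mul_mem_left _ _ (Ideal.subset_span ⟨i, rfl⟩)

theorem range_subset_range_snoc {r : ℕ} (f : Fin r → MvPolynomial (Fin n) K)
    (g : MvPolynomial (Fin n) K) :
    Set.range f ⊆ Set.range (Fin.snoc f g : Fin (r + 1) → MvPolynomial (Fin n) K) := by
  rintro _ ⟨i, rfl⟩
  exact ⟨i.castSucc, by simp⟩

theorem stdMon_anti {I J : Ideal (MvPolynomial (Fin n) K)} (h : I ≤ J) (t : ℕ) :
    stdMon J t ⊆ stdMon I t := by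
  rintro μ ⟨hμ, hμJ⟩
  refine ⟨hμ, fun hI => hμJ ?_⟩
  obtain ⟨p, hp, hlead⟩ := monomial_mem_initialIdeal_iff.1 hI
  exact monomial_mem_initialIdeal_iff.2 ⟨p, h hp, hlead⟩

theorem IsHomogIdeal.stdMon_subset {I J : Ideal (MvPolynomial (Fin n) K)} (hJ : IsHomogIdeal J)
    {t : ℕ} (h : ∀ p ∈ J, p.IsHomogeneous t → p ∈ I) : stdMon I t ⊆ stdMon J t := by
  rintro μ ⟨rfl, hμI⟩
  refine ⟨rfl, fun hμJ => hμI ?_⟩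
  obtain ⟨p, hp, hpt, hlead⟩ := hJ.exists_isLeadExp hμJ
  exact monomial_mem_initialIdeal_iff.2 ⟨p, h p hp hpt, hlead⟩

theorem expDeg_eq_zero_iff {μ : Fin n →₀ ℕ} : expDeg μ = 0 ↔ μ = 0 := by
  rw [expDeg_eq_degree, Finsupp.degree_eq_zero_iff]

theorem stdMon_span_zero {ι : Type*} (φ : ι → MvPolynomial (Fin n) K) (e : ι → ℕ)
    (hφ : ∀ i, (φ i).IsHomogeneous (e i)) (he : ∀ i, 1 ≤ e i) :
    stdMon (Ideal.span (Set.range φ)) 0 = {0} := by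
  ext μ
  rw [Set.mem_singleton_iff, ← expDeg_eq_zero_iff]
  refine ⟨fun h => h.1, fun h => ⟨h, fun hμ => ?_⟩⟩
  obtain ⟨p, hp, hp0, hlead⟩ := (isHomogIdeal_span φ e hφ).exists_isLeadExp hμ
  have h1 := homogeneousComponent_mem_span_monomial_mul φ e hφ 0 hp
  rw [h] at hp0
  rw [homogeneousComponent_eq_self hp0] at h1
  have : IsEmpty {p : ι × (Fin n →₀ ℕ) // p.2.degree + e p.1 = 0} :=
    ⟨fun q => by have := he q.1.1; have := q.2; omega⟩
  rw [Set.range_eq_empty, Submodule.span_empty, Submodule.mem_bot] at h1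
  exact mem_support_iff.1 hlead.1 (by simp [h1])

end extend

section genericExtension

variable {F K : Type*} [Field F] [Field K] [Algebra F K] {n : ℕ} {d : Fin n → ℕ} {D : ℕ}

theorem IsGenericSeq.init {m r : ℕ} {d : Fin r → ℕ} {f : Fin r → MvPolynomial (Fin m) K}
    {g : MvPolynomial (Fin m) K}
    (hf : IsGenericSeq F (Fin.snoc d D : Fin (r + 1) → ℕ) (Fin.snoc f g)) : IsGenericSeq F d f := by
  have h := hf.comp Fin.castSucc (Fin.castSucc_injective _)
  have h1 : (Fin.snoc d D : Fin (r + 1) → ℕ) ∘ Fin.castSucc = d := by ext i; simp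
  have h2 : (Fin.snoc f g : Fin (r + 1) → MvPolynomial (Fin m) K) ∘ Fin.castSucc = f := by
    funext i; simp
  rwa [h1, h2] at h

theorem IsGenericSeq.max_mem_initialIdeal {r : ℕ} {d : Fin r → ℕ}
    {f : Fin r → MvPolynomial (Fin n) K} {g : MvPolynomial (Fin n) K}
    (hf : IsGenericSeq F (Fin.snoc d D : Fin (r + 1) → ℕ) (Fin.snoc f g)) {μ₀ : Fin n →₀ ℕ}
    (hμ₀ : μ₀ ∈ stdMon (Ideal.span (Set.range f)) D)
    (hmax : ∀ ν ∈ stdMon (Ideal.span (Set.range f)) D, ν ≠ μ₀ → DrlLT ν μ₀) :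
    monomial μ₀ (1 : K) ∈ initialIdeal
      (Ideal.span (Set.range (Fin.snoc f g : Fin (r + 1) → MvPolynomial (Fin n) K))) := by
  set W := stdMon (Ideal.span (Set.range f)) D \ {μ₀}
  set f₀ : Fin (r + 1) → MvPolynomial (Fin n) K := Fin.snoc f (monomial μ₀ 1)
  have hinit := hf.init
  have h₀ : SpansForms W (Ideal.span (Set.range (f₀ ∘ id))) D := by
    refine ((isHomogIdeal_span f d hinit.1).spansForms_stdMon D).trans (sup_le ?_ ?_)
    · refine Submodule.span_le.2 ?_
      rintro _ ⟨ν, hν, rfl⟩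
      by_cases h : ν = μ₀
      · subst h
        exact Submodule.mem_sup_right (Ideal.subset_span ⟨Fin.last r, by simp [f₀]⟩)
      · exact Submodule.mem_sup_left (Submodule.subset_span ⟨ν, ⟨hν, h⟩, rfl⟩)
    · exact le_sup_of_le_right (Ideal.span_mono (range_subset_range_snoc f _))
  refine (hf.spansForms (W := W) (t := D) (fun μ hμ => hμ.1.1) id f₀ (fun i => ?_)
    h₀).mem_initialIdeal hμ₀.1 fun ν hν => hmax ν hν.1 hν.2
  induction i using Fin.lastCases with
  | last => simpa [f₀] using isHomogeneous_monomial (1 : K) hμ₀.1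
  | cast i => simpa [f₀] using hinit.1 i

theorem map_projMap_span_range {ι : Type*} (f : ι → MvPolynomial (Fin (n + 1)) K) :
    (Ideal.span (Set.range f)).map (projMap K n) =
      Ideal.span (Set.range fun i => projMap K n (f i)) := by
  rw [Ideal.map_span, ← Set.range_comp]
  rfl

theorem projMap_snoc {r : ℕ} (f : Fin r → MvPolynomial (Fin (n + 1)) K)
    (g : MvPolynomial (Fin (n + 1)) K) :
    (fun i => projMap K n ((Fin.snoc f g : Fin (r + 1) → MvPolynomial (Fin (n + 1)) K) i)) =
      Fin.snoc (fun i => projMap K n (f i)) (projMap K n g) := by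
  funext i
  induction i using Fin.lastCases <;> simp

variable {f : Fin n → MvPolynomial (Fin (n + 1)) K} {g : MvPolynomial (Fin (n + 1)) K}

theorem IsGenericSeq.proj_snoc
    (hfg : IsGenericSeq F (Fin.snoc d D : Fin (n + 1) → ℕ) (Fin.snoc f g)) :
    IsGenericSeq F (Fin.snoc d D : Fin (n + 1) → ℕ)
      (Fin.snoc (fun i => projMap K n (f i)) (projMap K n g)) :=
  projMap_snoc f g ▸ hfg.proj

theorem IsGenericSeq.ncard_stdMon_proj_snoc [Infinite K]
    (hfg : IsGenericSeq F (Fin.snoc d D : Fin (n + 1) → ℕ) (Fin.snoc f g)) (hD : 1 ≤ D) {i : ℕ}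
    (h : 2 * i + D + n < ∑ j, d j + 1) :
    (stdMon (Ideal.span (Set.range (Fin.snoc (fun i => projMap K n (f i)) (projMap K n g) :
        Fin (n + 1) → MvPolynomial (Fin n) K))) (D + i)).ncard +
      (stdMon (Ideal.span (Set.range fun i => projMap K n (f i))) i).ncard =
        (stdMon (Ideal.span (Set.range fun i => projMap K n (f i))) (D + i)).ncard := by
  have h1 := hfg.ncard_stdMon_succ (j := D + i - 1)
    (by rw [Fin.sum_univ_castSucc]; simp; omega)
  have h2 := ncard_boxSet_snoc (d := d) (t := D + i) hD (by omega)
  rw [map_projMap_span_range, projMap_snoc, hfg.ncard_stdMon, hfg.ncard_stdMon,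
    Nat.sub_add_cancel (by omega)] at h1
  rw [hfg.proj_snoc.init.ncard_stdMon, hfg.proj_snoc.init.ncard_stdMon]
  rw [Nat.add_sub_cancel_left] at h2
  omega

theorem IsGenericSeq.stdMon_succ_snoc [Infinite K]
    (hfg : IsGenericSeq F (Fin.snoc d D : Fin (n + 1) → ℕ) (Fin.snoc f g)) {t : ℕ} (ht : 1 ≤ t)
    (h : 2 * t + n < ∑ j, d j + D + 1) :
    stdMon (Ideal.span (Set.range (Fin.snoc f g : Fin (n + 1) → MvPolynomial (Fin (n + 1)) K))) t =
      embExp '' stdMon (Ideal.span (Set.range (Fin.snoc (fun i => projMap K n (f i))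
          (projMap K n g) : Fin (n + 1) → MvPolynomial (Fin n) K))) t ∪
        zShift 1 '' stdMon (Ideal.span (Set.range
          (Fin.snoc f g : Fin (n + 1) → MvPolynomial (Fin (n + 1)) K))) (t - 1) := by
  have h1 := hfg.stdMon_succ (j := t - 1) (by rw [Fin.sum_univ_castSucc]; simp; omega)
  rwa [map_projMap_span_range, projMap_snoc, Nat.sub_add_cancel ht] at h1

theorem IsGenericSeq.exists_stdMon_diff [Infinite K]
    (hfg : IsGenericSeq F (Fin.snoc d D : Fin (n + 1) → ℕ) (Fin.snoc f g)) (hD : 1 ≤ D) {i : ℕ}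
    (h : 2 * i + D + n < ∑ j, d j + 1) :
    ∃ T ⊆ stdMon (Ideal.span (Set.range fun i => projMap K n (f i))) (D + i),
      T.ncard = (stdMon (Ideal.span (Set.range fun i => projMap K n (f i))) i).ncard ∧
      stdMon (Ideal.span (Set.range (Fin.snoc (fun i => projMap K n (f i)) (projMap K n g) :
        Fin (n + 1) → MvPolynomial (Fin n) K))) (D + i) =
        stdMon (Ideal.span (Set.range fun i => projMap K n (f i))) (D + i) \ T := by
  have hsub := stdMon_anti (Ideal.span_mono
    (range_subset_range_snoc (fun i => projMap K n (f i)) (projMap K n g))) (D + i)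
  refine ⟨_, Set.sdiff_subset (t := stdMon (Ideal.span (Set.range
    (Fin.snoc (fun i => projMap K n (f i)) (projMap K n g) :
      Fin (n + 1) → MvPolynomial (Fin n) K))) (D + i)), ?_, (Set.sdiff_sdiff_cancel_left hsub).symm⟩
  have h1 := hfg.ncard_stdMon_proj_snoc hD h
  have h2 := Set.ncard_sdiff_add_ncard_of_subset hsub (stdMon_finite _ _)
  omega

end genericExtension

/-- structure of the standard monomials `F = B(n+1; d_1,…,d_n,d)` of the generic
ideal `(I,g)` when `d < δ`. -/
theorem stmt12 {F K : Type*} [Field F] [Field K] [Algebra F K] [Infinite K]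
    {n : ℕ} (hn : 0 < n) (d : Fin n → ℕ) (hd : ∀ i, 1 ≤ d i) (hmono : Monotone d)
    (D : ℕ) (hdD : ∀ i, d i ≤ D)
    (f : Fin n → MvPolynomial (Fin (n + 1)) K) (g : MvPolynomial (Fin (n + 1)) K)
    (hfg : IsGenericSeq F (Fin.snoc d D) (Fin.snoc f g))
    (I Ig : Ideal (MvPolynomial (Fin (n + 1)) K))
    (hI : I = Ideal.span (Set.range f)) (hIg : Ig = Ideal.span (Set.range (Fin.snoc f g)))
    (J : Ideal (MvPolynomial (Fin n) K)) (hJ : J = I.map (projMap K n))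
    (δ istar : ℕ) (hδ : δ = (∑ j, d j) - n) (hDδ : D < δ) (histar : istar = (δ - D) / 2) :
    (stdMon Ig 0 = {0}) ∧
    (∀ i : ℕ, 1 ≤ i → i + 1 ≤ D →
      stdMon Ig i = embExp '' stdMon J i ∪ zShift 1 '' stdMon Ig (i - 1)) ∧
    (∃ μ0 ∈ stdMon J D, (∀ ν ∈ stdMon J D, ν ≠ μ0 → DrlLT ν μ0) ∧
      stdMon Ig D = embExp '' (stdMon J D \ {μ0}) ∪ zShift 1 '' stdMon Ig (D - 1)) ∧
    (Even (δ - D) → ∃ T : ℕ → Set (Fin n →₀ ℕ),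
      ∀ i : ℕ, 1 ≤ i → i ≤ istar - 1 →
        T i ⊆ stdMon J (D + i) ∧ (T i).ncard = (stdMon J i).ncard ∧
        stdMon Ig (D + i) =
          embExp '' (stdMon J (D + i) \ T i) ∪ zShift 1 '' stdMon Ig (D + i - 1)) ∧
    (Odd (δ - D) → ∃ T : ℕ → Set (Fin n →₀ ℕ),
      ∀ i : ℕ, 1 ≤ i → i ≤ istar →
        T i ⊆ stdMon J (D + i) ∧ (T i).ncard = (stdMon J i).ncard ∧
        stdMon Ig (D + i) =
          embExp '' (stdMon J (D + i) \ T i) ∪ zShift 1 '' stdMon Ig (D + i - 1)) ∧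
    (Even (δ - D) → ∀ k : ℕ, D + istar ≤ k → k ≤ δ + D - 1 →
      stdMon Ig k =
        zShift (2 * (k - D - istar) + 1) '' stdMon Ig (2 * (D + istar) - 1 - k)) ∧
    (Odd (δ - D) → ∀ k : ℕ, D + istar + 1 ≤ k → k ≤ δ + D - 1 →
      stdMon Ig k = zShift (2 * (k - D - istar)) '' stdMon Ig (2 * (D + istar) - k)) := by
  have hD : 1 ≤ D := (hd ⟨0, hn⟩).trans (hdD _)
  have hJ' : J = Ideal.span (Set.range fun i => projMap K n (f i)) := by
    rw [hJ, hI, map_projMap_span_range]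
  have hsum : ∑ j, d j = δ + n := by omega
  have hsnoc : ∑ j, (Fin.snoc d D : Fin (n + 1) → ℕ) j = δ + n + D := by
    rw [Fin.sum_univ_castSucc]
    simp [hsum]
  have hproj := hfg.proj_snoc
  have key : ∀ i, 2 * i + D ≤ δ → ∃ T ⊆ stdMon J (D + i), T.ncard = (stdMon J i).ncard ∧
      stdMon Ig (D + i) =
        embExp '' (stdMon J (D + i) \ T) ∪ zShift 1 '' stdMon Ig (D + i - 1) := by
    intro i hi
    obtain ⟨T, hT, hcard, heq⟩ := hfg.exists_stdMon_diff hD (i := i) (by omega)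
    subst hJ' hIg
    exact ⟨T, hT, hcard, heq ▸ hfg.stdMon_succ_snoc (by omega) (by omega)⟩
  have hsymm : ∀ j k, j ≤ k → j + k + 1 = δ + D →
      stdMon Ig k = zShift (k - j) '' stdMon Ig j := by
    intro j k hjk h
    subst hIg
    exact hfg.stdMon_eq_zShift_image hjk (by omega)
  refine ⟨?_, fun i hi hiD => ?_, ?_, fun he => ?_, fun ho => ?_, fun he k hk hk' => ?_,
    fun ho k hk hk' => ?_⟩
  · subst hIg
    refine stdMon_span_zero _ _ hfg.1 fun i => ?_
    induction i using Fin.lastCases with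
    | last => simpa using hD
    | cast i => simpa using hd i
  · have h1 := hfg.stdMon_succ_snoc hi (by omega)
    have hg := hproj.1 (Fin.last n)
    simp only [Fin.snoc_last] at hg
    rw [← hIg] at h1
    rw [h1, hJ', (stdMon_anti (Ideal.span_mono (range_subset_range_snoc _ _)) i).antisymm
      ((isHomogIdeal_span _ _ hproj.1).stdMon_subset fun p hp hpt =>
        mem_of_isHomogeneous_of_mem_span_snoc hproj.init.1 hg (by omega) hpt hp)]
  · obtain ⟨T, hT, hcard, heq⟩ := hfg.exists_stdMon_diff hD (i := 0) (by omega)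
    rw [stdMon_span_zero _ _ hproj.init.1 hd, Set.ncard_singleton, Set.ncard_eq_one] at hcard
    obtain ⟨ξ, rfl⟩ := hcard
    obtain ⟨μ₀, hμ₀, hmax⟩ := exists_drl_max (stdMon_finite J D)
      ⟨ξ, hJ' ▸ Set.singleton_subset_iff.1 hT⟩
    have h1 := hfg.stdMon_succ_snoc hD (by omega)
    rw [← hIg] at h1
    rw [hJ'] at hμ₀ hmax
    have hξ : μ₀ = ξ := by
      by_contra hne
      have h2 : μ₀ ∈ stdMon (Ideal.span (Set.range (Fin.snoc (fun i => projMap K n (f i))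
        (projMap K n g) : Fin (n + 1) → MvPolynomial (Fin n) K))) D := by
        rw [← Nat.add_zero D, heq]
        exact ⟨hμ₀, hne⟩
      exact h2.2 (hproj.max_mem_initialIdeal hμ₀ hmax)
    subst hJ' hξ
    exact ⟨μ₀, hμ₀, hmax, heq ▸ h1⟩
  · rw [Nat.even_iff] at he
    choose! T hT using key
    exact ⟨T, fun i hi hi' => hT i (by omega)⟩
  · rw [Nat.odd_iff] at ho
    choose! T hT using key
    exact ⟨T, fun i hi hi' => hT i (by omega)⟩
  · rw [Nat.even_iff] at he
    rw [hsymm (2 * (D + istar) - 1 - k) k (by omega) (by omega)]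
    congr 2
    omega
  · rw [Nat.odd_iff] at ho
    rw [hsymm (2 * (D + istar) - k) k (by omega) (by omega)]
    congr 2
    omega
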